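/- arXiv:2510.25251 — 5 statements merged into one kernel-verified Lean document; each statement's English description precedes it below -/
import Mathlib

section
/- Let k be a positive integer, χ a Dirichlet character modulo N with values in ℂ, and let a : ℕ → ℂ satisfy the normalized Hecke eigenform coefficient conditions of weight k and character χ. Fix a prime p and define b : ℕ → ℂ by b(n) = a(n) if p ∤ n and b(n) = 0 if p ∣ n. If the Dirichlet series L(a, s) = Σ_{n≥1} a(n) n^{−s} converges absolutely at a complex number s, then L(b, s) = L(a, s) · (1 − a(p)·p^{−s} + χ(p)·p^{k−1−2s}). -/
/-- Placing the values of `f` on the multiples of `d ≠ 0` does not change its sum. -/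
theorem HasSum.dilate {f : ℕ → ℂ} {S : ℂ} (hf : HasSum f S) {d : ℕ} (hd : d ≠ 0) :
    HasSum (fun n ↦ if d ∣ n then f (n / d) else 0) S := by
  have hinj : Function.Injective (fun n : ℕ ↦ d * n) := mul_right_injective₀ hd
  rw [← hinj.hasSum_iff]
  · convert hf using 1
    funext n
    simp [Nat.mul_div_cancel_left n (Nat.pos_of_ne_zero hd)]
  · intro n hn
    refine if_neg fun ⟨m, hm⟩ ↦ hn ⟨m, hm.symm⟩

/-- Placing `a m` at `d * m` multiplies the corresponding L-series term by `d ^ (-s)`. -/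
theorem LSeries.cpow_neg_mul_term_div (a : ℕ → ℂ) (s : ℂ) {d n : ℕ} (hn : n ≠ 0) :
    (d : ℂ) ^ (-s) * (if d ∣ n then LSeries.term a s (n / d) else 0) =
      (if d ∣ n then a (n / d) else 0) / (n : ℂ) ^ s := by
  split_ifs with h
  · obtain ⟨m, rfl⟩ := h
    obtain ⟨hd, hm⟩ := mul_ne_zero_iff.mp hn
    rw [Nat.mul_div_cancel_left m (Nat.pos_of_ne_zero hd), LSeries.term_of_ne_zero hm,
      Nat.cast_mul, Complex.natCast_mul_natCast_cpow, Complex.cpow_neg]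
    field_simp
  · simp

/-- Multiplying by the Euler polynomial `1 - a p X + c X²` at `p` removes the coefficients at
multiples of `p`, provided `a` satisfies the corresponding recursion at powers of `p`. -/
theorem ite_dvd_eq_sub_add_of_recursion {a : ℕ → ℂ} {p : ℕ} (hp : p.Prime) {c : ℂ}
    (hrec : ∀ r : ℕ, a (p ^ (r + 2)) = a p * a (p ^ (r + 1)) - c * a (p ^ r))
    (hmul : ∀ m n : ℕ, Nat.Coprime m n → a (m * n) = a m * a n) {n : ℕ} (hn : n ≠ 0) :
    (if p ∣ n then 0 else a n) = a n - a p * (if p ∣ n then a (n / p) else 0) +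
      c * (if p ^ 2 ∣ n then a (n / p ^ 2) else 0) := by
  obtain ⟨r, m, hm, rfl⟩ := Nat.exists_eq_pow_mul_and_not_dvd hn p hp.ne_one
  have hsplit (j : ℕ) : a (p ^ j * m) = a (p ^ j) * a m :=
    hmul _ _ (((Nat.Prime.coprime_iff_not_dvd hp).mpr hm).pow_left j)
  match r with
  | 0 =>
    have h2 : ¬ p ^ 2 ∣ m := fun h ↦ hm ((dvd_pow_self p two_ne_zero).trans h)
    simp [hm, h2]
  | 1 =>
    have h2 : ¬ p ^ 2 ∣ p * m := by
      rw [pow_two, Nat.mul_dvd_mul_iff_left hp.pos]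
      exact hm
    have h1 := hsplit 1
    rw [pow_one] at h1
    simp [h2, h1, Nat.mul_div_cancel_left m hp.pos]
  | r + 2 =>
    have e1 : p ^ (r + 2) * m = p * (p ^ (r + 1) * m) := by ring
    have e2 : p ^ (r + 2) * m = p ^ 2 * (p ^ r * m) := by ring
    have d1 : p ^ (r + 2) * m / p = p ^ (r + 1) * m := by
      rw [e1, Nat.mul_div_cancel_left _ hp.pos]
    have d2 : p ^ (r + 2) * m / p ^ 2 = p ^ r * m := by
      rw [e2, Nat.mul_div_cancel_left _ (pow_pos hp.pos 2)]
    rw [if_pos (Dvd.intro _ e1.symm), if_pos (Dvd.intro _ e1.symm),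
      if_pos (Dvd.intro _ e2.symm), d1, d2, hsplit, hsplit, hsplit, hrec]
    ring


/-- **L-series of the twist by `χ_{p²}`.**
If `a : ℕ → ℂ` satisfies the normalized Hecke eigenform coefficient conditions of weight `k`
and character `χ` (mod `N`), `p` is a prime, and `b` agrees with `a` away from multiples of `p`
and vanishes on multiples of `p`, then whenever the L-series of `a` converges absolutely at `s`,
we have `L(b, s) = L(a, s) * (1 - a p * p^{-s} + χ p * p^{k-1-2s})`. -/
theorem LSeries_twist_by_p_squared
    (N k : ℕ) (hN : 0 < N) (hk : 0 < k) (χ : DirichletCharacter ℂ N)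
    (a : ℕ → ℂ)
    (ha1 : a 1 = 1)
    (ha2 : ∀ p r : ℕ, p.Prime → 2 ≤ r →
      a (p ^ r) = a p * a (p ^ (r - 1)) -
        χ (p : ZMod N) * (p : ℂ) ^ (k - 1) * a (p ^ (r - 2)))
    (ha3 : ∀ m n : ℕ, Nat.Coprime m n → a (m * n) = a m * a n)
    (p : ℕ) (hp : p.Prime)
    (b : ℕ → ℂ) (hb : ∀ n : ℕ, b n = if p ∣ n then 0 else a n)
    (s : ℂ) (hs : LSeriesSummable a s) :
    LSeries b s = LSeries a s *
      (1 - a p * (p : ℂ) ^ (-s) + χ (p : ZMod N) * (p : ℂ) ^ ((k : ℂ) - 1 - 2 * s)) := by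
  have hp0 : (p : ℂ) ≠ 0 := Nat.cast_ne_zero.mpr hp.ne_zero
  have hcoeff {n : ℕ} (hn : n ≠ 0) := ite_dvd_eq_sub_add_of_recursion hp
    (fun r ↦ ha2 p (r + 2) hp (by lia)) ha3 hn
  have hpow : (p : ℂ) ^ ((k : ℂ) - 1 - 2 * s) =
      (p : ℂ) ^ (k - 1) * ((p ^ 2 : ℕ) : ℂ) ^ (-s) := by
    rw [show (k : ℂ) - 1 - 2 * s = ((k - 1 : ℕ) : ℂ) + (-s + -s) by
        rw [Nat.cast_pred hk]; ring,
      Complex.cpow_add _ _ hp0, Complex.cpow_natCast, Complex.cpow_add _ _ hp0, pow_two,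
      Nat.cast_mul, Complex.natCast_mul_natCast_cpow]
  have hsum : LSeriesHasSum a s (LSeries a s) := hs.LSeriesHasSum
  have hcomb := (HasSum.sub hsum
    ((hsum.dilate hp.ne_zero).mul_left (a p * (p : ℂ) ^ (-s)))).add
    ((hsum.dilate (pow_ne_zero 2 hp.ne_zero)).mul_left
      (χ (p : ZMod N) * (p : ℂ) ^ ((k : ℂ) - 1 - 2 * s)))
  have hterm (n : ℕ) : LSeries.term b s n = LSeries.term a s n -
      a p * (p : ℂ) ^ (-s) * (if p ∣ n then LSeries.term a s (n / p) else 0) +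
      χ (p : ZMod N) * (p : ℂ) ^ ((k : ℂ) - 1 - 2 * s) *
        (if p ^ 2 ∣ n then LSeries.term a s (n / p ^ 2) else 0) := by
    rcases eq_or_ne n 0 with rfl | hn
    · simp
    · rw [hpow, mul_assoc (a p), LSeries.cpow_neg_mul_term_div a s hn, ← mul_assoc (χ _),
        mul_assoc (χ _ * _), LSeries.cpow_neg_mul_term_div a s hn,
        LSeries.term_of_ne_zero hn, LSeries.term_of_ne_zero hn, hb, hcoeff hn]
      ring
  rw [LSeries, tsum_congr hterm, hcomb.tsum_eq]
  ring
end

section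
/- Let d be a nonzero squarefree integer and let E_d be the elliptic curve over ℚ defined by y² = x³ − 35d²x − 98d³. Then for every prime q ≥ 5, the group E_d(ℚ) contains no point of order q. -/
/-- The quadratic twist `E_d : y² = x³ − 35d²x − 98d³` of `X₀(49)`, as a Weierstrass curve
over `ℚ`. -/
def Ed (d : ℤ) : WeierstrassCurve.Affine ℚ :=
  { a₁ := 0, a₂ := 0, a₃ := 0, a₄ := -35 * (d : ℚ) ^ 2, a₆ := -98 * (d : ℚ) ^ 3 }

/-- A `2`-adic integer vanishing modulo `2` has norm less than one. -/
lemma norm_lt_one_of_toZMod_eq_zero {z : ℤ_[2]} (h : PadicInt.toZMod z = 0) : ‖z‖ < 1 := by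
  rwa [← RingHom.mem_ker, PadicInt.ker_toZMod, IsLocalRing.mem_maximalIdeal,
    PadicInt.mem_nonunits] at h

/-- A `2`-adic integer that is nonzero modulo `2` has norm one. -/
lemma norm_eq_one_of_toZMod_ne_zero {z : ℤ_[2]} (h : PadicInt.toZMod z ≠ 0) : ‖z‖ = 1 := by
  refine (PadicInt.norm_le_one z).antisymm (not_lt.1 fun hz => h ?_)
  rwa [← RingHom.mem_ker, PadicInt.ker_toZMod, IsLocalRing.mem_maximalIdeal,
    PadicInt.mem_nonunits]

/-- `IsDouble X X'` says that `X'` is the abscissa of the double of a point of abscissa `X` on the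
minimal model `Y² + XY = X³ - X² - 2X - 1` of `X₀(49)`. -/
def IsDouble {K : Type*} [Field K] (X X' : K) : Prop :=
  X' * (4 * X ^ 3 - 3 * X ^ 2 - 8 * X - 4) = X ^ 4 + 4 * X ^ 2 + 8 * X + 1

/-- Doubling a point of the kernel of reduction modulo `2` enlarges the norm of its abscissa. -/
lemma IsDouble.norm_lt_norm {X X' : ℚ_[2]} (h : IsDouble X X') (hX : 1 < ‖X‖) : ‖X‖ < ‖X'‖ := by
  have hX0 : X ≠ 0 := norm_pos_iff.1 (one_pos.trans hX)
  have hw1 : ‖X⁻¹‖ < 1 := by rw [norm_inv]; exact inv_lt_one_of_one_lt₀ hX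
  obtain ⟨w, hw⟩ : ∃ w : ℤ_[2], (w : ℚ_[2]) = X⁻¹ := ⟨⟨X⁻¹, hw1.le⟩, rfl⟩
  have hwz : PadicInt.toZMod w = 0 := by
    by_contra hne
    have := norm_eq_one_of_toZMod_ne_zero hne
    rw [PadicInt.norm_def, hw] at this
    exact hw1.ne this
  have hc : ‖4 - 3 * w - 8 * w ^ 2 - 4 * w ^ 3‖ < 1 := by
    apply norm_lt_one_of_toZMod_eq_zero
    simp only [map_sub, map_mul, map_pow, map_ofNat, hwz]
    decide
  have hu : ‖1 + 4 * w ^ 2 + 8 * w ^ 3 + w ^ 4‖ = 1 := by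
    apply norm_eq_one_of_toZMod_ne_zero
    simp only [map_add, map_one, map_mul, map_pow, map_ofNat, hwz]
    decide
  have key : X' * ((4 - 3 * w - 8 * w ^ 2 - 4 * w ^ 3 : ℤ_[2]) : ℚ_[2]) =
      X * ((1 + 4 * w ^ 2 + 8 * w ^ 3 + w ^ 4 : ℤ_[2]) : ℚ_[2]) := by
    push_cast
    rw [hw, show ((4 : ℤ_[2]) : ℚ_[2]) = 4 from rfl, show ((3 : ℤ_[2]) : ℚ_[2]) = 3 from rfl,
      show ((8 : ℤ_[2]) : ℚ_[2]) = 8 from rfl]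
    unfold IsDouble at h
    field_simp
    linear_combination h
  have hnorm := congrArg norm key
  rw [norm_mul, norm_mul, ← PadicInt.norm_def, ← PadicInt.norm_def, hu, mul_one] at hnorm
  have hX' : 0 < ‖X'‖ := by
    refine norm_pos_iff.2 fun h0 => ?_
    rw [h0, norm_zero, zero_mul] at hnorm
    linarith
  rw [← hnorm]
  exact mul_lt_of_lt_one_right hX' hc

lemma IsDouble.norm_lt_one {X X' : ℚ_[2]} (h : IsDouble X X') (hX : ‖X‖ = 1) : ‖X'‖ < 1 := by
  obtain ⟨x, rfl⟩ : ∃ x : ℤ_[2], (x : ℚ_[2]) = X := ⟨⟨X, hX.le⟩, rfl⟩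
  have hxz : PadicInt.toZMod x = 1 := by
    have hne : PadicInt.toZMod x ≠ 0 := fun h0 =>
      (norm_lt_one_of_toZMod_eq_zero h0).ne hX
    revert hne
    generalize PadicInt.toZMod x = t
    revert t
    decide
  have hden : ‖4 * x ^ 3 - 3 * x ^ 2 - 8 * x - 4‖ = 1 := by
    apply norm_eq_one_of_toZMod_ne_zero
    simp only [map_sub, map_mul, map_pow, map_ofNat, hxz]
    decide
  have hnum : ‖x ^ 4 + 4 * x ^ 2 + 8 * x + 1‖ < 1 := by
    apply norm_lt_one_of_toZMod_eq_zero
    simp only [map_add, map_one, map_mul, map_pow, map_ofNat, hxz]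
    decide
  have key : X' * ((4 * x ^ 3 - 3 * x ^ 2 - 8 * x - 4 : ℤ_[2]) : ℚ_[2]) =
      ((x ^ 4 + 4 * x ^ 2 + 8 * x + 1 : ℤ_[2]) : ℚ_[2]) := by
    push_cast
    exact h
  have hnorm := congrArg norm key
  rw [norm_mul, ← PadicInt.norm_def, ← PadicInt.norm_def, hden, mul_one] at hnorm
  rwa [hnorm]

lemma IsDouble.one_lt_norm {X X' : ℚ_[2]} (h : IsDouble X X') (hX : ‖X‖ < 1) : 1 < ‖X'‖ := by
  obtain ⟨x, rfl⟩ : ∃ x : ℤ_[2], (x : ℚ_[2]) = X := ⟨⟨X, hX.le⟩, rfl⟩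
  have hxz : PadicInt.toZMod x = 0 := by
    by_contra hne
    exact hX.ne (norm_eq_one_of_toZMod_ne_zero hne)
  have hden : ‖4 * x ^ 3 - 3 * x ^ 2 - 8 * x - 4‖ < 1 := by
    apply norm_lt_one_of_toZMod_eq_zero
    simp only [map_sub, map_mul, map_pow, map_ofNat, hxz]
    decide
  have hnum : ‖x ^ 4 + 4 * x ^ 2 + 8 * x + 1‖ = 1 := by
    apply norm_eq_one_of_toZMod_ne_zero
    simp only [map_add, map_one, map_mul, map_pow, map_ofNat, hxz]
    decide
  have key : X' * ((4 * x ^ 3 - 3 * x ^ 2 - 8 * x - 4 : ℤ_[2]) : ℚ_[2]) =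
      ((x ^ 4 + 4 * x ^ 2 + 8 * x + 1 : ℤ_[2]) : ℚ_[2]) := by
    push_cast
    exact h
  have hnorm := congrArg norm key
  rw [norm_mul, ← PadicInt.norm_def, ← PadicInt.norm_def, hnum] at hnorm
  by_contra! hle
  nlinarith [norm_nonneg (4 * x ^ 3 - 3 * x ^ 2 - 8 * x - 4), norm_nonneg X']

/-- A `2`-adic orbit of the duplication map of `X₀(49)` is not periodic. -/
lemma not_periodic_of_isDouble {X : ℕ → ℚ_[2]} (h : ∀ n, IsDouble (X n) (X (n + 1)))
    {k : ℕ} (hk : 0 < k) : ¬ X.Periodic k := by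
  intro hper
  obtain ⟨n, hn⟩ : ∃ n, 1 < ‖X n‖ := by
    rcases lt_trichotomy ‖X 0‖ 1 with h0 | h0 | h0
    · exact ⟨1, (h 0).one_lt_norm h0⟩
    · exact ⟨2, (h 1).one_lt_norm ((h 0).norm_lt_one h0)⟩
    · exact ⟨0, h0⟩
  have hgt (j : ℕ) : 1 < ‖X (n + j)‖ := by
    induction j with
    | zero => exact hn
    | succ j ih => exact ih.trans ((h (n + j)).norm_lt_norm ih)
  have hmono : StrictMono fun j => ‖X (n + j)‖ :=
    strictMono_nat_of_lt_succ fun j => (h (n + j)).norm_lt_norm (hgt j)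
  have := hmono hk
  simp only [hper n, add_zero, lt_irrefl] at this

/-- The abscissa, on the minimal model of `X₀(49)`, of a point of its twist `Ed d`; the point at
infinity is sent to `0`. -/
def minimalX (d : ℤ) : (Ed d).Point → ℚ
  | .zero => 0
  | .some x _ _ => (x / d + 1) / 4

lemma isDouble_minimalX {d : ℤ} (hd0 : d ≠ 0) {P : (Ed d).Point} (hP : P + P ≠ 0) :
    IsDouble (minimalX d P) (minimalX d (P + P)) := by
  have hd : (d : ℚ) ≠ 0 := Int.cast_ne_zero.2 hd0
  rcases P with _ | ⟨x, y, hxy⟩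
  · exact absurd (add_zero _) hP
  have hy : y ≠ (Ed d).negY x y := fun hy =>
    hP (WeierstrassCurve.Affine.Point.add_self_of_Y_eq hy)
  rw [WeierstrassCurve.Affine.Point.add_self_of_Y_ne hy]
  have heq := ((Ed d).equation_iff x y).1 hxy.1
  have hslope := (Ed d).slope_of_Y_ne (x₁ := x) rfl hy
  simp only [minimalX, WeierstrassCurve.Affine.addX, hslope]
  simp only [Ed, WeierstrassCurve.Affine.negY] at hy heq ⊢
  have hy0 : y ≠ 0 := by
    rintro rfl
    simp at hy
  have hy2 : y - (-y - 0 * x - 0) = 2 * y := by ring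
  have hysq : y ^ 2 = x ^ 3 - 35 * d ^ 2 * x - 98 * d ^ 3 := by linear_combination heq
  rw [hy2]
  unfold IsDouble
  have hden : 4 * ((x / d + 1) / 4) ^ 3 - 3 * ((x / d + 1) / 4) ^ 2 - 8 * ((x / d + 1) / 4) - 4 =
      y ^ 2 / (16 * (d : ℚ) ^ 3) := by
    rw [hysq]
    field_simp
    ring
  rw [hden]
  field_simp
  linear_combination (256 * d - 512 * x) * hysq

/-- **No torsion of large prime order on the twists of `X₀(49)`.**
For `d` a nonzero squarefree integer and any prime `q ≥ 5`, the group `E_d(ℚ)` of rational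
points on `E_d : y² = x³ − 35d²x − 98d³` contains no point of order `q`. -/
theorem no_order_q_point_on_Ed (d : ℤ) (hd0 : d ≠ 0) (hd : Squarefree d)
    (q : ℕ) (hq : q.Prime) (hq5 : 5 ≤ q) :
    ∀ P : (Ed d).Point, addOrderOf P ≠ q := by
  intro P hP
  have hcop : Nat.Coprime 2 q := (Nat.coprime_primes Nat.prime_two hq).2 (by lia)
  have hne (n : ℕ) : 2 ^ n • P ≠ 0 := fun h0 => by
    rw [← addOrderOf_dvd_iff_nsmul_eq_zero, hP] at h0
    exact hq.one_lt.ne' ((hcop.symm.pow_right n).eq_one_of_dvd h0)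
  have hsucc (n : ℕ) : 2 ^ (n + 1) • P = 2 ^ n • P + 2 ^ n • P := by
    rw [← add_nsmul, pow_succ, mul_two]
  refine not_periodic_of_isDouble (X := fun n => (minimalX d (2 ^ n • P) : ℚ_[2]))
    (fun n => ?_) (Nat.totient_pos.2 hq.pos) fun n => ?_
  · have h := isDouble_minimalX hd0 (P := 2 ^ n • P) (hsucc n ▸ hne (n + 1))
    rw [← hsucc] at h
    unfold IsDouble at h ⊢
    exact_mod_cast h
  · have h : 2 ^ (n + q.totient) • P = 2 ^ n • P := by
      rw [nsmul_eq_nsmul_iff_modEq, hP, pow_add]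
      simpa using (Nat.ModEq.pow_totient hcop).mul_left (2 ^ n)
    simp only [h]
end

section
/- Let d be a nonzero squarefree integer and let E_d be the elliptic curve over ℚ defined by y² = x³ − 35d²x − 98d³. Then E_d(ℚ) contains no point of order 3. -/
/-- The `3`-division polynomial of `y² = x³ − 35x − 98` has no rational root. -/
lemma three_division_polynomial_ne_zero (t : ℚ) :
    3 * t ^ 4 - 210 * t ^ 2 - 1176 * t - 1225 ≠ 0 := by
  intro h
  have hq : (t.den : ℚ) ≠ 0 := by exact_mod_cast t.den_nz
  rw [← Rat.num_div_den t] at h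
  field_simp at h
  have hz : 3 * t.num ^ 4 - 210 * t.num ^ 2 * (t.den : ℤ) ^ 2 - 1176 * t.num * (t.den : ℤ) ^ 3
      - 1225 * (t.den : ℤ) ^ 4 = 0 := by
    have : ((3 * t.num ^ 4 - 210 * t.num ^ 2 * (t.den : ℤ) ^ 2
      - 1176 * t.num * (t.den : ℤ) ^ 3 - 1225 * (t.den : ℤ) ^ 4 : ℤ) : ℚ) = 0 := by
      push_cast
      linear_combination h
    exact_mod_cast this
  have hcop : IsCoprime t.num (t.den : ℤ) := Rat.isCoprime_num_den t
  generalize t.num = p at hz hcop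
  generalize (t.den : ℤ) = q at hz hcop
  have hp3 : Prime (3 : ℤ) := Int.prime_three
  have h3q : (3 : ℤ) ∣ q := hp3.dvd_of_dvd_pow (n := 4)
    ⟨p ^ 4 - 70 * p ^ 2 * q ^ 2 - 392 * p * q ^ 3 - 408 * q ^ 4, by linear_combination -hz⟩
  obtain ⟨r, rfl⟩ := h3q
  have h3p : (3 : ℤ) ∣ p := hp3.dvd_of_dvd_pow (n := 4)
    ⟨210 * p ^ 2 * r ^ 2 + 3528 * p * r ^ 3 + 11025 * r ^ 4, by linarith⟩
  exact hp3.not_isUnit (hcop.isUnit_of_dvd' h3p (dvd_mul_right 3 r))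

/-- The `x`-coordinate of a point of order `3` on `E_d` satisfies `12xy² = (3x² − 35d²)²`. -/
lemma twelve_mul_X_mul_Y_sq_of_addOrderOf_eq_three {d : ℤ} {x y : ℚ}
    {h : (Ed d).Nonsingular x y}
    (hP : addOrderOf (WeierstrassCurve.Affine.Point.some x y h) = 3) :
    12 * x * y ^ 2 = (3 * x ^ 2 - 35 * (d : ℚ) ^ 2) ^ 2 := by
  set P := WeierstrassCurve.Affine.Point.some x y h with hPdef
  have hdbl : P + P = -P := by
    have h3 : 3 • P = 0 := hP ▸ addOrderOf_nsmul_eq_zero P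
    rw [eq_neg_iff_add_eq_zero, ← h3]
    abel
  by_cases hy : y = (Ed d).negY x y
  · rw [hPdef, WeierstrassCurve.Affine.Point.add_self_of_Y_eq hy, ← hPdef, eq_comm,
      neg_eq_zero] at hdbl
    exact absurd hdbl (WeierstrassCurve.Affine.Point.some_ne_zero h)
  · have hy0 : y ≠ 0 := fun h0 => hy (by simp [WeierstrassCurve.Affine.negY, Ed, h0])
    rw [hPdef, WeierstrassCurve.Affine.Point.add_self_of_Y_ne hy,
      WeierstrassCurve.Affine.Point.neg_some, WeierstrassCurve.Affine.Point.some.injEq] at hdbl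
    have hx := hdbl.1
    rw [WeierstrassCurve.Affine.slope_of_Y_ne rfl hy] at hx
    simp only [WeierstrassCurve.Affine.addX, WeierstrassCurve.Affine.negY, Ed] at hx
    have h2 : y - (-y - 0 * x - 0) = 2 * y := by ring
    rw [h2] at hx
    field_simp at hx
    linear_combination -hx

/-- **No 3-torsion on the twists of `X₀(49)`.**
For `d` a nonzero squarefree integer, the group `E_d(ℚ)` of rational points on
`E_d : y² = x³ − 35d²x − 98d³` contains no point of order `3`. -/
theorem no_order_three_point_on_Ed (d : ℤ) (hd0 : d ≠ 0) (hd : Squarefree d) :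
    ∀ P : (Ed d).Point, addOrderOf P ≠ 3 := by
  rintro (_ | ⟨x, y, h⟩) hP
  · rw [← WeierstrassCurve.Affine.Point.zero_def, addOrderOf_zero] at hP
    norm_num at hP
  · have hd' : (d : ℚ) ≠ 0 := by exact_mod_cast hd0
    have key := twelve_mul_X_mul_Y_sq_of_addOrderOf_eq_three hP
    have heq := (WeierstrassCurve.Affine.equation_iff _ _).1 h.1
    simp only [Ed] at heq
    apply three_division_polynomial_ne_zero (x / d)
    field_simp
    linear_combination key - 12 * x * heq
end

section
/- Let d be a nonzero squarefree integer and let E_d be the elliptic curve over ℚ defined by y² = x³ − 35d²x − 98d³. Then E_d(ℚ) contains no point of order 4. -/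
/-- A point of `E_d` with vanishing `y`-coordinate has `x`-coordinate `7d`. -/
lemma Ed_x_eq_of_equation_zero {d : ℤ} (hd0 : d ≠ 0) {x : ℚ} (h : (Ed d).Equation x 0) :
    x = 7 * d := by
  have hd : (d : ℚ) ≠ 0 := Int.cast_ne_zero.mpr hd0
  have h' := (WeierstrassCurve.Affine.equation_iff ..).mp h
  simp only [Ed] at h'
  have hmul : (x - 7 * d) * (x ^ 2 + 7 * d * x + 14 * d ^ 2) = 0 := by linear_combination -h'
  rcases mul_eq_zero.mp hmul with h₁ | h₁
  · linarith
  · nlinarith [sq_nonneg (2 * x + 7 * d), sq_pos_of_ne_zero hd]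

/-- An affine point of `E_d` killed by `2` has `x`-coordinate `7d`. -/
lemma Ed_x_eq_of_add_self_eq_zero {d : ℤ} (hd0 : d ≠ 0) {x y : ℚ} (h : (Ed d).Nonsingular x y)
    (h2 : WeierstrassCurve.Affine.Point.some x y h + .some x y h = 0) : x = 7 * d := by
  by_cases hy : y = (Ed d).negY x y
  · have hy0 : y = 0 := by
      simp only [Ed, WeierstrassCurve.Affine.negY] at hy
      linarith
    exact Ed_x_eq_of_equation_zero hd0 (hy0 ▸ h.1)
  · rw [WeierstrassCurve.Affine.Point.add_self_of_Y_ne hy] at h2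
    exact absurd h2 (WeierstrassCurve.Affine.Point.some_ne_zero _)

/-- The tangent line to `E_d` at `(x, y)` never meets the curve again at `(7d, 0)`. -/
lemma Ed_addX_slope_ne {d : ℤ} (hd0 : d ≠ 0) {x y : ℚ} (h : (Ed d).Equation x y)
    (hy : y ≠ (Ed d).negY x y) :
    (Ed d).addX x x ((Ed d).slope x x y y) ≠ 7 * d := by
  intro hX
  have hd : (d : ℚ) ≠ 0 := Int.cast_ne_zero.mpr hd0
  have h' := (WeierstrassCurve.Affine.equation_iff ..).mp h
  rw [WeierstrassCurve.Affine.slope_of_Y_ne rfl hy] at hX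
  simp only [Ed, WeierstrassCurve.Affine.negY, WeierstrassCurve.Affine.addX] at h' hX hy
  have hy0 : y ≠ 0 := by
    rintro rfl
    simp at hy
  have hden : y - (-y - 0 * x - 0) = 2 * y := by ring
  rw [hden] at hX
  field_simp at hX
  have hsq : ((x - 7 * d) ^ 2 - 112 * d ^ 2) ^ 2 = 0 := by
    linear_combination hX + 4 * (2 * x + 7 * d) * h'
  have hu : (x - 7 * d) ^ 2 = 112 * (d : ℚ) ^ 2 :=
    sub_eq_zero.mp (pow_eq_zero_iff two_ne_zero |>.mp hsq)
  have h7 : IsSquare ((7 : ℕ) : ℚ) := by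
    refine ⟨(x - 7 * d) / (4 * d), ?_⟩
    field_simp
    push_cast
    linear_combination -hu
  exact (by norm_num : Nat.Prime 7).prime.not_isSquare (Rat.isSquare_natCast_iff.mp h7)

/-- **No 4-torsion on the twists of `X₀(49)`.**
For `d` a nonzero squarefree integer, the group `E_d(ℚ)` of rational points on
`E_d : y² = x³ − 35d²x − 98d³` contains no point of order `4`. -/
theorem no_order_four_point_on_Ed (d : ℤ) (hd0 : d ≠ 0) (hd : Squarefree d) :
    ∀ P : (Ed d).Point, addOrderOf P ≠ 4 := by
  intro P hP
  have h4 : 4 • P = 0 := hP ▸ addOrderOf_nsmul_eq_zero P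
  have h2 : P + P ≠ 0 := by
    rw [← two_nsmul]
    exact nsmul_ne_zero_of_lt_addOrderOf two_ne_zero (by omega)
  have h22 : (P + P) + (P + P) = 0 := by
    rw [← two_nsmul, ← two_nsmul, smul_smul]
    exact h4
  rcases P with _ | ⟨x, y, h⟩
  · exact h2 (add_zero _)
  · by_cases hy : y = (Ed d).negY x y
    · exact h2 (WeierstrassCurve.Affine.Point.add_self_of_Y_eq hy)
    · rw [WeierstrassCurve.Affine.Point.add_self_of_Y_ne hy] at h22
      exact Ed_addX_slope_ne hd0 h.1 hy (Ed_x_eq_of_add_self_eq_zero hd0 _ h22)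
end

section
/- Let E₁ be the elliptic curve over ℚ with minimal Weierstrass equation y² + xy = x³ − x² − 2x − 1 (the modular curve X₀(49)). For every prime p ≥ 5 with p ≠ 7, the trace of Frobenius a_p = p + 1 − #E₁(𝔽_p) satisfies: a_p = 0 if and only if the Legendre symbol (−7 / p) equals −1. -/
/-- Quadratic reciprocity for `-7`. -/
lemma isSquare_natCast_zmod_seven {q : ℕ} [Fact q.Prime] (h : IsSquare (-7 : ZMod q)) :
    IsSquare (q : ZMod 7) := by
  have : Fact (Nat.Prime 7) := ⟨by norm_num⟩
  have hq : q.Prime := Fact.out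
  rcases eq_or_ne q 2 with rfl | h2
  · exact ⟨3, rfl⟩
  rcases eq_or_ne q 7 with rfl | h7
  · exact ⟨0, rfl⟩
  have h7' : ((7 : ℕ) : ZMod q) = 7 := by norm_cast
  rcases hq.eq_two_or_odd.resolve_left h2 |> fun h => (by lia : q % 4 = 1 ∨ q % 4 = 3) with h4 | h4
  · rw [← ZMod.exists_sq_eq_prime_iff_of_mod_four_eq_one h4 (by norm_num), h7']
    have := (ZMod.exists_sq_eq_neg_one_iff (p := q)).2 (by lia)
    simpa using this.mul h
  · by_contra hn
    have h' := (ZMod.exists_sq_eq_prime_iff_of_mod_four_eq_three h4 (by norm_num) h7).2 hn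
    rw [h7'] at h'
    have h0 : (7 : ZMod q) ≠ 0 := by
      rw [← h7', Ne, ZMod.natCast_eq_zero_iff]
      exact fun h ↦ h7 ((Nat.prime_dvd_prime_iff_eq hq (by norm_num)).1 h)
    have h'' := h.div h'
    rw [neg_div, div_self h0, ZMod.exists_sq_eq_neg_one_iff] at h''
    exact h'' h4

open AddSubgroup in
/-- The order of a finite module over `ℤ[X] / (X² - X + 2)` is a square modulo `7`. -/
lemma isSquare_card_of_quadratic_endomorphism {G : Type*} [AddCommGroup G] [Finite G]
    (α : G →+ G) (hα : ∀ x, α (α x) = α x - 2 • x) : IsSquare (Nat.card G : ZMod 7) := by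
  induction hn : Nat.card G using Nat.strong_induction_on generalizing G with
  | _ n ih =>
  subst hn
  by_cases h1 : Nat.card G = 1
  · simp [h1]
  obtain ⟨q, hq, hqG⟩ := Nat.exists_prime_and_dvd h1
  have : Fact q.Prime := ⟨hq⟩
  obtain ⟨x, hx⟩ := exists_prime_addOrderOf_dvd_card' q hqG
  let H := zmultiples x ⊔ zmultiples (α x)
  have hxH : x ∈ H := (le_sup_left : _ ≤ H) (mem_zmultiples x)
  have hαH : α x ∈ H := (le_sup_right : _ ≤ H) (mem_zmultiples (α x))
  have hH : H ≤ H.comap α := by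
    refine sup_le ?_ ?_ <;> rw [zmultiples_le, mem_comap]
    · exact hαH
    · rw [hα]; exact sub_mem hαH (nsmul_mem hxH 2)
  have hqx : q • x = 0 := hx ▸ addOrderOf_nsmul_eq_zero x
  have hcardx : Nat.card (zmultiples x) = q := by rw [Nat.card_zmultiples, hx]
  have hcardH : IsSquare (Nat.card H : ZMod 7) := by
    by_cases hmem : α x ∈ zmultiples x
    · have : H = zmultiples x := sup_eq_left.2 (by rwa [zmultiples_le])
      rw [this, hcardx]
      obtain ⟨k, hk⟩ := mem_zmultiples_iff.1 hmem
      apply isSquare_natCast_zmod_seven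
      have h0 : (k * k - k + 2) • x = 0 := by
        have := hα x
        rw [← hk, map_zsmul, ← hk] at this
        rw [add_smul, sub_smul, mul_smul, this, ofNat_zsmul]
        abel
      rw [← addOrderOf_dvd_iff_zsmul_eq_zero, hx, ← ZMod.intCast_zmod_eq_zero_iff_dvd] at h0
      refine ⟨2 * k - 1, ?_⟩
      push_cast at h0
      linear_combination -4 * h0
    · have hαx : addOrderOf (α x) = q := by
        refine addOrderOf_eq_prime (by rw [← map_nsmul, hqx, map_zero]) ?_
        intro h
        exact hmem (h ▸ zero_mem _)
      have hdvd : (zmultiples x).relIndex (zmultiples (α x)) ∣ q := by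
        rw [← hαx, ← Nat.card_zmultiples]
        exact relIndex_dvd_card _ _
      have hne : (zmultiples x).relIndex (zmultiples (α x)) ≠ 1 := by
        rwa [Ne, relIndex_eq_one, zmultiples_le]
      have hH : Nat.card H = q * q := by
        rw [← relIndex_bot_left, ← relIndex_mul_relIndex ⊥ (zmultiples x) H bot_le le_sup_left,
          relIndex_bot_left, hcardx, relIndex_sup_left, ((Nat.dvd_prime hq).1 hdvd).resolve_left hne]
      exact ⟨q, by rw [hH, Nat.cast_mul]⟩
  have hquot : IsSquare (Nat.card (G ⧸ H) : ZMod 7) := by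
    refine ih _ ?_ (QuotientAddGroup.map H H α hH) ?_ rfl
    · rw [card_eq_card_quotient_mul_card_addSubgroup H]
      refine lt_mul_of_one_lt_right Nat.card_pos ?_
      refine hq.one_lt.trans_le ?_
      rw [← hcardx]
      exact Nat.card_le_card_of_injective _ (inclusion_injective (le_sup_left : _ ≤ H))
    · rintro ⟨y⟩
      exact congrArg (QuotientAddGroup.mk (s := H)) (hα y)
  rw [card_eq_card_quotient_mul_card_addSubgroup H, Nat.cast_mul]
  exact hquot.mul hcardH

section CharSum

variable {F : Type*} [Field F] [Fintype F] [DecidableEq F]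

/-- The number of affine points of `y² = f(x)` in terms of a quadratic character sum. -/
lemma card_sq_eq_add_sum_quadraticChar (hF : ringChar F ≠ 2) (f : F → F) :
    (Nat.card {xy : F × F // xy.2 ^ 2 = f xy.1} : ℤ) =
      Fintype.card F + ∑ x, quadraticChar F (f x) := by
  let e : {xy : F × F // xy.2 ^ 2 = f xy.1} ≃ Σ x : F, {y : F // y ^ 2 = f x} :=
    { toFun := fun z ↦ ⟨z.1.1, z.1.2, z.2⟩
      invFun := fun z ↦ ⟨(z.1, z.2.1), z.2.2⟩
      left_inv := fun _ ↦ rfl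
      right_inv := fun _ ↦ rfl }
  have h (x : F) : (Nat.card {y : F // y ^ 2 = f x} : ℤ) = 1 + quadraticChar F (f x) := by
    rw [add_comm, ← quadraticChar_card_sqrts hF, Set.toFinset_card, Nat.card_eq_fintype_card]
    norm_cast
  rw [Nat.card_congr e, Nat.card_sigma, Nat.cast_sum, Finset.sum_congr rfl fun x _ ↦ h x,
    Finset.sum_add_distrib, Finset.sum_const, Finset.card_univ, nsmul_one]

/-- A character sum is invariant, up to a factor, under affine substitutions. -/
lemma sum_quadraticChar_eq_zero_iff {f g : F → F} {a b c d : F} (ha : a ≠ 0) (hc : c ≠ 0)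
    (hd : d ≠ 0) (h : ∀ x, c * f (a * x + b) = d * g x) :
    ∑ x, quadraticChar F (f x) = 0 ↔ ∑ x, quadraticChar F (g x) = 0 := by
  have hbij : Function.Bijective fun x ↦ a * x + b :=
    Finite.injective_iff_bijective.1 fun x y hxy ↦ mul_left_cancel₀ ha (add_right_cancel hxy)
  have h1 : quadraticChar F c * ∑ x, quadraticChar F (f x) =
      quadraticChar F d * ∑ x, quadraticChar F (g x) := by
    rw [← hbij.sum_comp, Finset.mul_sum, Finset.mul_sum]
    exact Finset.sum_congr rfl fun x _ ↦ by rw [← map_mul, ← map_mul, h]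
  have hc' := quadraticChar_eq_zero_iff.not.2 hc
  have hd' := quadraticChar_eq_zero_iff.not.2 hd
  constructor <;> intro h0 <;> rw [h0, mul_zero] at h1
  · exact (mul_eq_zero.1 h1.symm).resolve_left hd'
  · exact (mul_eq_zero.1 h1).resolve_left hc'

open Polynomial in
/-- The power sum formula: only the coefficient of `X ^ (q - 1)` contributes. -/
lemma sum_eval_eq_neg_coeff {f : F[X]} (hf : f.natDegree < 2 * (Fintype.card F - 1)) :
    ∑ x, f.eval x = -f.coeff (Fintype.card F - 1) := by
  have hq : 1 < Fintype.card F := Fintype.one_lt_card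
  have hpow (i : ℕ) (hi : i < 2 * (Fintype.card F - 1)) :
      ∑ x : F, x ^ i = if i = Fintype.card F - 1 then -1 else 0 := by
    rcases lt_trichotomy i (Fintype.card F - 1) with h | rfl | h
    · rw [if_neg h.ne, FiniteField.sum_pow_lt_card_sub_one _ _ h]
    · have (x : F) : x ^ (Fintype.card F - 1) = 1 - if x = 0 then 1 else 0 := by
        split_ifs with hx
        · rw [hx, zero_pow (by lia), sub_self]
        · rw [FiniteField.pow_card_sub_one_eq_one x hx, sub_zero]
      simp [this]
    · rw [if_neg h.ne', ← FiniteField.sum_pow_lt_card_sub_one F (i - (Fintype.card F - 1)) (by lia)]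
      refine Finset.sum_congr rfl fun x _ ↦ ?_
      obtain ⟨k, rfl⟩ : ∃ k, i = Fintype.card F + k := ⟨i - Fintype.card F, by lia⟩
      rw [pow_add, FiniteField.pow_card, ← pow_succ']
      congr 1
      lia
  simp_rw [eval_eq_sum_range]
  rw [Finset.sum_comm]
  simp_rw [← Finset.mul_sum]
  rw [Finset.sum_congr rfl fun i hi ↦ by rw [hpow i (by rw [Finset.mem_range] at hi; lia)]]
  simp only [mul_ite, mul_neg, mul_one, mul_zero, Finset.sum_ite_eq', Finset.mem_range]
  split_ifs with h
  · rfl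
  · rw [coeff_eq_zero_of_natDegree_lt (by lia), neg_zero]

end CharSum

section Hasse

open Polynomial

variable {K : Type*} [Field K] (p : ℕ)

/-- The Hasse invariant of the curve `y² = f(x)` in characteristic `p`. -/
noncomputable def hasseCoeff (f : K[X]) : K := (f ^ (p / 2)).coeff (p - 1)

lemma hasseCoeff_C_mul (c : K) (f : K[X]) :
    hasseCoeff p (C c * f) = c ^ (p / 2) * hasseCoeff p f := by
  rw [hasseCoeff, mul_pow, ← C_pow, coeff_C_mul, hasseCoeff]

lemma hasseCoeff_comp_C_mul_X (c : K) (f : K[X]) :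
    hasseCoeff p (f.comp (C c * X)) = c ^ (p - 1) * hasseCoeff p f := by
  rw [hasseCoeff, ← pow_comp, comp_C_mul_X_coeff, hasseCoeff, mul_comm]

variable [Fact p.Prime] [CharP K p]

lemma hasseCoeff_comp_X_add_C (hp : Odd p) {f : K[X]} (hf : f.natDegree ≤ 3) (c : K) :
    hasseCoeff p (f.comp (X + C c)) = hasseCoeff p f := by
  have hp' : p.Prime := Fact.out
  obtain ⟨m, hm⟩ := hp
  have hdeg : (f ^ (p / 2)).natDegree ≤ 3 * m := by
    refine natDegree_pow_le.trans ?_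
    rw [show p / 2 = m by lia, mul_comm]
    gcongr
  rw [hasseCoeff, ← pow_comp, ← taylor_apply, taylor_coeff, hasseCoeff]
  suffices h : hasseDeriv (p - 1) (f ^ (p / 2)) = C ((f ^ (p / 2)).coeff (p - 1)) by
    rw [h, eval_C]
  ext n
  rw [hasseDeriv_coeff, coeff_C]
  split_ifs with hn
  · simp [hn]
  · rcases le_or_gt (n + (p - 1)) (3 * m) with h | h
    · have := hp'.two_le
      rw [(CharP.cast_eq_zero_iff K p _).2 (hp'.dvd_choose (by lia) (by lia) (by lia)), zero_mul]
    · rw [coeff_eq_zero_of_natDegree_lt (hdeg.trans_lt h), mul_zero]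

lemma hasseCoeff_comp_linear (hp : Odd p) {f : K[X]} (hf : f.natDegree ≤ 3) (a b : K) :
    hasseCoeff p (f.comp (C a * X + C b)) = a ^ (p - 1) * hasseCoeff p f := by
  rw [← hasseCoeff_comp_X_add_C p hp hf b, ← hasseCoeff_comp_C_mul_X, comp_assoc]
  simp

omit [Fact p.Prime] in
/-- `(-4) ^ j * (m choose j) = (2 * j choose j)` in characteristic `p = 2m + 1`. -/
lemma choose_mul_neg_four_pow {m : ℕ} (hm : p = 2 * m + 1) {j : ℕ} (hj : j ≤ m) :
    (m.choose j : K) * (-4) ^ j = j.centralBinom := by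
  induction j with
  | zero => simp
  | succ j ih =>
    have h0 : ((j + 1 : ℕ) : K) ≠ 0 := by
      rw [Ne, CharP.cast_eq_zero_iff K p]
      exact fun h ↦ by have := Nat.le_of_dvd (by lia) h; lia
    apply mul_left_cancel₀ h0
    have hp0 : (2 * m + 1 : K) = 0 := by
      have := CharP.cast_eq_zero K p
      rw [hm] at this
      exact_mod_cast this
    have h1 := congrArg (Nat.cast (R := K)) (Nat.succ_mul_centralBinom_succ j)
    have h2 := congrArg (Nat.cast (R := K)) (Nat.choose_succ_right_eq m j)
    specialize ih (by lia)
    push_cast [Nat.cast_sub (show j ≤ m by lia)] at h1 h2 ⊢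
    rw [h1, ← ih]
    linear_combination (-4) ^ (j + 1) * h2 - 2 * (m.choose j : K) * (-4) ^ j * hp0

omit [Fact p.Prime] [CharP K p] in
lemma coeff_X_sq_add_C_pow (b : K) (n k : ℕ) :
    ((X ^ 2 + C b) ^ n).coeff k =
      if 2 ∣ k then b ^ (n - k / 2) * (n.choose (k / 2) : K) else 0 := by
  rw [← coeff_X_add_C_pow, ← coeff_expand two_pos]
  simp

omit [Fact p.Prime] in
/-- The Hasse invariant is preserved by the `2`-isogeny with kernel generated by `(0, 0)`. -/
lemma hasseCoeff_two_isogeny (hp : Odd p) (a b : K) :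
    hasseCoeff p (X * (X ^ 2 + C a * X + C b)) =
      hasseCoeff p ((X + C a) * (X ^ 2 + C (-4 * b))) := by
  obtain ⟨m, hm⟩ := hp
  have hm2 : p / 2 = m := by lia
  have hpm : p - 1 = m + m := by lia
  have hl : (X * (X ^ 2 + C a * X + C b) : K[X]) ^ m =
      ∑ i ∈ Finset.range (m + 1),
        C (a ^ (m - i) * m.choose i) * ((X ^ 2 + C b) ^ i * X ^ (m + (m - i))) := by
    rw [mul_pow, show (X ^ 2 + C a * X + C b : K[X]) = (X ^ 2 + C b) + C a * X by ring,
      add_pow, Finset.mul_sum]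
    refine Finset.sum_congr rfl fun i _ ↦ ?_
    simp only [C_mul, C_pow, map_natCast]
    ring
  have hr : ((X + C a) * (X ^ 2 + C (-4 * b)) : K[X]) ^ m =
      ∑ i ∈ Finset.range (m + 1),
        C (a ^ (m - i) * m.choose i) * ((X ^ 2 + C (-4 * b)) ^ m * X ^ i) := by
    rw [mul_pow, add_pow, Finset.sum_mul]
    refine Finset.sum_congr rfl fun i _ ↦ ?_
    simp only [C_mul, C_pow, map_natCast]
    ring
  rw [hasseCoeff, hasseCoeff, hm2, hpm, hl, hr, finsetSum_coeff, finsetSum_coeff]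
  refine Finset.sum_congr rfl fun i hi ↦ ?_
  have hi' : i ≤ m := by rw [Finset.mem_range] at hi; lia
  rw [coeff_C_mul, coeff_C_mul, coeff_mul_X_pow', coeff_mul_X_pow', if_pos (by lia),
    if_pos (by lia), coeff_X_sq_add_C_pow, coeff_X_sq_add_C_pow]
  congr 1
  rw [show m + m - (m + (m - i)) = i by lia]
  by_cases h2 : 2 ∣ i
  · obtain ⟨j, rfl⟩ := h2
    rw [if_pos (by lia), if_pos (by lia), show 2 * j / 2 = j by lia,
      show (m + m - 2 * j) / 2 = m - j by lia, Nat.choose_symm (by lia),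
      show 2 * j - j = j by lia, show m - (m - j) = j by lia, ← Nat.centralBinom_eq_two_mul_choose,
      ← choose_mul_neg_four_pow p hm (by lia)]
    ring
  · rw [if_neg h2, if_neg (by lia)]

/-- A curve with complex multiplication by `ω = (1 + √-7) / 2` is supersingular in
characteristic `p` if `ω` is not in the prime field. -/
lemma hasseCoeff_eq_zero_of_pow_ne_one (hp : Odd p) {ω : K} (hω : ω ^ 2 = ω - 2)
    (h : ω ^ (p - 1) ≠ 1) :
    hasseCoeff p (X * (X ^ 2 + C (3 * ω) * X + C ((1 - ω) ^ 4))) = 0 := by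
  have hω0 : ω ≠ 0 := by
    rintro rfl
    have h2 : ((2 : ℕ) : K) = 0 := by push_cast; linear_combination hω
    rw [CharP.cast_eq_zero_iff K p, Nat.prime_dvd_prime_iff_eq Fact.out Nat.prime_two] at h2
    rw [h2] at hp
    exact absurd hp (by decide)
  set g : K[X] := X * (X ^ 2 + C (3 * ω) * X + C ((1 - ω) ^ 4)) with hg
  set g' : K[X] := (X + C (3 * ω)) * (X ^ 2 + C (-4 * (1 - ω) ^ 4)) with hg'
  have hiso : hasseCoeff p g = hasseCoeff p g' := hasseCoeff_two_isogeny p hp _ _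
  have hcomp : g'.comp (C (ω ^ 2) * X + C (2 * (1 - ω) ^ 2)) = C (ω ^ 6) * g := by
    have hC : (C ω : K[X]) ^ 2 = C ω - 2 := by
      rw [← C_pow, hω, C_sub, C_ofNat]
    simp only [hg, hg', mul_comp, add_comp, X_comp, C_comp, pow_comp]
    simp only [C_mul, C_pow, C_sub, C_1, C_neg, C_ofNat]
    generalize (C ω : K[X]) = w at hC ⊢
    clear * - hC
    grind
  have hdeg : g'.natDegree ≤ 3 := by
    rw [hg']; compute_degree
  have key := hasseCoeff_comp_linear p hp hdeg (ω ^ 2) (2 * (1 - ω) ^ 2)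
  rw [hcomp, hasseCoeff_C_mul, hiso] at key
  by_contra h0
  apply h
  have := mul_right_cancel₀ (hiso ▸ h0) key
  obtain ⟨m, hm⟩ := hp
  rw [show p / 2 = m by lia, show p - 1 = 2 * m by lia, ← pow_mul, ← pow_mul] at this
  rw [show p - 1 = 2 * m by lia]
  apply mul_left_cancel₀ (pow_ne_zero (4 * m) hω0)
  rw [← pow_add, mul_one, show 4 * m + 2 * m = 6 * m by ring, this]
  ring

/-- The Legendre symbol criterion for `ω ^ (p - 1) = 1`. -/
lemma isSquare_neg_seven_of_pow_eq_one {ω : K} (hω : ω ^ 2 = ω - 2) (h : ω ^ (p - 1) = 1) :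
    IsSquare (-7 : ZMod p) := by
  have hp : p.Prime := Fact.out
  have hmem : ω ∈ (⊥ : Subfield K) := by
    rw [Subfield.mem_bot_iff_pow_eq_self K p, ← Nat.sub_add_cancel hp.one_le, pow_succ, h,
      one_mul]
  rw [← ZMod.fieldRange_castHom_eq_bot p] at hmem
  obtain ⟨w, rfl⟩ := hmem
  rw [← map_pow] at hω
  refine ⟨2 * w - 1, (ZMod.castHom dvd_rfl K).injective ?_⟩
  simp only [map_mul, map_sub, map_neg, map_ofNat, map_one, map_pow] at hω ⊢
  linear_combination -4 * hω

end Hasse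

section Supersingular

open Polynomial

lemma hasseCoeff_map {K L : Type*} [Field K] [Field L] (φ : K →+* L) (p : ℕ) (f : K[X]) :
    hasseCoeff p (f.map φ) = φ (hasseCoeff p f) := by
  rw [hasseCoeff, hasseCoeff, ← Polynomial.map_pow, coeff_map]

variable {p : ℕ} [Fact p.Prime]

/-- A character sum of a polynomial of degree at most three vanishes modulo `p` exactly when the
Hasse invariant does. -/
lemma intCast_sum_quadraticChar_eval (hp : p ≠ 2) {f : (ZMod p)[X]} (hf : f.natDegree ≤ 3) :
    ((∑ x, quadraticChar (ZMod p) (f.eval x) : ℤ) : ZMod p) = -hasseCoeff p f := by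
  have hp' : p.Prime := Fact.out
  have hodd := hp'.odd_of_ne_two hp
  have h2 : ringChar (ZMod p) ≠ 2 := by rwa [ZMod.ringChar_zmod_n]
  have hdeg : (f ^ (p / 2)).natDegree < 2 * (Fintype.card (ZMod p) - 1) := by
    refine natDegree_pow_le.trans_lt ?_
    rw [ZMod.card]
    obtain ⟨m, hm⟩ := hodd
    have := hp'.two_le
    calc p / 2 * f.natDegree ≤ p / 2 * 3 := by gcongr
      _ < 2 * (p - 1) := by lia
  rw [Int.cast_sum, hasseCoeff]
  have := sum_eval_eq_neg_coeff hdeg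
  rw [ZMod.card] at this
  rw [← this]
  refine Finset.sum_congr rfl fun x _ ↦ ?_
  rw [quadraticChar_eq_pow_of_char_ne_two' h2, ZMod.card, eval_pow]

lemma sum_quadraticChar_eq_zero_of_dvd {F : Type*} [Field F] [Fintype F] [DecidableEq F]
    {f : F → F} {x₀ : F} (hx₀ : f x₀ = 0)
    (h : (Fintype.card F : ℤ) ∣ ∑ x, quadraticChar F (f x)) : ∑ x, quadraticChar F (f x) = 0 := by
  refine Int.eq_zero_of_abs_lt_dvd h ?_
  have hle (x : F) : |quadraticChar F (f x)| ≤ 1 := by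
    rcases eq_or_ne (f x) 0 with h0 | h0
    · simp [h0]
    · rcases quadraticChar_dichotomy h0 with h1 | h1 <;> simp [h1]
  calc |∑ x, quadraticChar F (f x)| ≤ ∑ x, |quadraticChar F (f x)| := Finset.abs_sum_le_sum_abs _ _
    _ < ∑ x : F, 1 := Finset.sum_lt_sum (fun x _ ↦ hle x) ⟨x₀, Finset.mem_univ _, by simp [hx₀]⟩
    _ = Fintype.card F := by simp

/-- Over `ℚ(√-7)`, the curve `X₀(49)` is isomorphic to one where `(0, 0)` generates the kernel of
multiplication by `(1 + √-7) / 2`. -/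
lemma cubic_comp_eq {K : Type*} [Field K] {ω : K} (hω : ω ^ 2 = ω - 2) (h4 : (4 : K) ≠ 0) (x : K) :
    16 * (4 * ((2 * ω - 1) / 4 * x + ((ω - 11) / 4 + 2)) ^ 3 -
      3 * ((2 * ω - 1) / 4 * x + ((ω - 11) / 4 + 2)) ^ 2 -
      8 * ((2 * ω - 1) / 4 * x + ((ω - 11) / 4 + 2)) - 4) =
      (2 * ω - 1) ^ 3 * (x * (x ^ 2 + 3 * ω * x + (1 - ω) ^ 4)) := by
  obtain ⟨t, ht⟩ : ∃ t, t = (2 * ω - 1) * x + (ω - 11) := ⟨_, rfl⟩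
  have h : (2 * ω - 1) / 4 * x + ((ω - 11) / 4 + 2) = t / 4 + 2 := by rw [ht]; ring
  have h' : 16 * (4 * (t / 4 + 2) ^ 3 - 3 * (t / 4 + 2) ^ 2 - 8 * (t / 4 + 2) - 4) =
      t ^ 3 + 21 * t ^ 2 + 112 * t := by field_simp; ring
  rw [h, h', ht]
  clear * - hω
  grind

lemma sum_quadraticChar_eq_zero_of_not_isSquare (hp : p ≠ 2) (h : ¬ IsSquare (-7 : ZMod p)) :
    ∑ x, quadraticChar (ZMod p) (4 * x ^ 3 - 3 * x ^ 2 - 8 * x - 4) = 0 := by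
  have hp' : p.Prime := Fact.out
  have hodd := hp'.odd_of_ne_two hp
  let f : (ZMod p)[X] := C 4 * X ^ 3 - C 3 * X ^ 2 - C 8 * X - C 4
  have hf (x : ZMod p) : 4 * x ^ 3 - 3 * x ^ 2 - 8 * x - 4 = f.eval x := by simp [f]
  have hdeg : f.natDegree ≤ 3 := by simp only [f]; compute_degree
  simp_rw [hf]
  refine sum_quadraticChar_eq_zero_of_dvd (x₀ := 2) (by rw [← hf]; ring) ?_
  rw [ZMod.card, ← ZMod.intCast_zmod_eq_zero_iff_dvd, intCast_sum_quadraticChar_eval hp hdeg,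
    neg_eq_zero]
  let K := AlgebraicClosure (ZMod p)
  have : CharP K p := charP_of_injective_algebraMap (algebraMap (ZMod p) K).injective p
  obtain ⟨ω, hω⟩ : ∃ ω : K, ω ^ 2 = ω - 2 := by
    obtain ⟨ω, hω⟩ := IsAlgClosed.exists_root (X ^ 2 - X + C 2 : K[X]) (by
      have : (X ^ 2 - X + C 2 : K[X]).degree = 2 := by compute_degree!
      simp [this])
    exact ⟨ω, by simp [IsRoot] at hω; linear_combination hω⟩
  have hω1 : ω ^ (p - 1) ≠ 1 := fun h1 ↦ h (isSquare_neg_seven_of_pow_eq_one p hω h1)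
  have hs : 2 * ω - 1 ≠ 0 := by
    intro h0
    have h7 : (-7 : K) = 0 := by linear_combination (2 * ω - 1) * h0 - 4 * hω
    refine h ⟨0, (algebraMap (ZMod p) K).injective ?_⟩
    rw [map_neg, map_ofNat, mul_zero, map_zero, h7]
  have h2 : (2 : K) ≠ 0 := by
    have : ((2 : ℕ) : K) ≠ 0 := by
      rwa [Ne, CharP.cast_eq_zero_iff K p, Nat.prime_dvd_prime_iff_eq hp' Nat.prime_two]
    exact_mod_cast this
  have h4 : (4 : K) ≠ 0 := by rw [show (4 : K) = 2 * 2 by norm_num]; exact mul_ne_zero h2 h2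
  have h16 : (16 : K) ≠ 0 := by rw [show (16 : K) = 4 * 4 by norm_num]; exact mul_ne_zero h4 h4
  have hcomp : C 16 * (f.map (algebraMap (ZMod p) K)).comp
      (C ((2 * ω - 1) / 4) * X + C ((ω - 11) / 4 + 2)) =
      C ((2 * ω - 1) ^ 3) * (X * (X ^ 2 + C (3 * ω) * X + C ((1 - ω) ^ 4))) := by
    refine Polynomial.funext fun x ↦ ?_
    simp only [f, Polynomial.map_sub, Polynomial.map_mul, Polynomial.map_pow, map_X,
      map_ofNat, Polynomial.map_ofNat, eval_ofNat, eval_mul, eval_comp, eval_sub, eval_add,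
      eval_pow, eval_X, eval_C]
    exact cubic_comp_eq hω h4 x
  have key := congrArg (hasseCoeff p) hcomp
  rw [hasseCoeff_C_mul, hasseCoeff_C_mul, hasseCoeff_eq_zero_of_pow_ne_one p hodd hω hω1, mul_zero,
    hasseCoeff_comp_linear p hodd (natDegree_map_le.trans hdeg), hasseCoeff_map] at key
  simpa [h16, hs, h4] using key

end Supersingular

section Isogeny

open WeierstrassCurve.Affine WeierstrassCurve.Affine.Point

variable {F : Type*} [Field F]

/-- The curve `y² = x³ + ax² + bx + c`. -/
def cubicCurve (a b c : F) : WeierstrassCurve.Affine F := ⟨0, a, 0, b, c⟩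

lemma cubicCurve_equation_iff {a b c x y : F} :
    (cubicCurve a b c).Equation x y ↔ y ^ 2 = x ^ 3 + a * x ^ 2 + b * x + c := by
  simp [equation_iff, cubicCurve]

lemma cubicCurve_negY (a b c x y : F) : (cubicCurve a b c).negY x y = -y := by
  simp [negY, cubicCurve]

lemma cubicCurve_neg {a b c x y : F} (h : (cubicCurve a b c).Nonsingular x y)
    (h' : (cubicCurve a b c).Nonsingular x (-y)) : -some x y h = some x (-y) h' := by
  rw [neg_some]
  simp only [cubicCurve_negY]

variable [DecidableEq F]

lemma cubicCurve_add {a b c x₁ y₁ x₂ y₂ x₃ y₃ ℓ : F} (h₁ : (cubicCurve a b c).Nonsingular x₁ y₁)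
    (h₂ : (cubicCurve a b c).Nonsingular x₂ y₂) (h₃ : (cubicCurve a b c).Nonsingular x₃ y₃)
    (hx : x₁ ≠ x₂) (hℓ : ℓ * (x₁ - x₂) = y₁ - y₂) (hx₃ : x₃ = ℓ ^ 2 - a - x₁ - x₂)
    (hy₃ : y₃ = ℓ * (x₁ - x₃) - y₁) : some x₁ y₁ h₁ + some x₂ y₂ h₂ = some x₃ y₃ h₃ := by
  have h : (cubicCurve a b c).slope x₁ x₂ y₁ y₂ = ℓ := by
    rw [slope_of_X_ne hx, ← hℓ, mul_div_cancel_right₀ _ (sub_ne_zero.2 hx)]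
  rw [add_of_X_ne hx, some.injEq, h]
  have h1 : (cubicCurve a b c).addX x₁ x₂ ℓ = x₃ := by
    rw [hx₃]; simp [addX, cubicCurve]
  refine ⟨h1, ?_⟩
  rw [addY, negAddY, h1, cubicCurve_negY, hy₃]
  ring

lemma cubicCurve_double {a b c x y x₃ y₃ ℓ : F} (h : (cubicCurve a b c).Nonsingular x y)
    (h₃ : (cubicCurve a b c).Nonsingular x₃ y₃) (hy : 2 * y ≠ 0)
    (hℓ : ℓ * (2 * y) = 3 * x ^ 2 + 2 * a * x + b) (hx₃ : x₃ = ℓ ^ 2 - a - 2 * x)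
    (hy₃ : y₃ = ℓ * (x - x₃) - y) : some x y h + some x y h = some x₃ y₃ h₃ := by
  have hy' : y ≠ (cubicCurve a b c).negY x y := by
    rw [cubicCurve_negY]
    exact fun h ↦ hy (by linear_combination h)
  have h : (cubicCurve a b c).slope x x y y = ℓ := by
    rw [slope_of_Y_ne rfl hy', cubicCurve_negY, sub_neg_eq_add, ← two_mul, div_eq_iff hy, hℓ]
    simp [cubicCurve]
  rw [add_self_of_Y_ne hy', some.injEq, h]
  have h1 : (cubicCurve a b c).addX x x ℓ = x₃ := by
    rw [hx₃]; simp [addX, cubicCurve]; ring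
  refine ⟨h1, ?_⟩
  rw [addY, negAddY, h1, cubicCurve_negY, hy₃]
  ring

lemma cubicCurve_exists_add {a b c x₁ y₁ x₂ y₂ : F} (h₁ : (cubicCurve a b c).Nonsingular x₁ y₁)
    (h₂ : (cubicCurve a b c).Nonsingular x₂ y₂) (hx : x₁ ≠ x₂) :
    ∃ ℓ x₃ y₃, ∃ h₃ : (cubicCurve a b c).Nonsingular x₃ y₃, ℓ * (x₁ - x₂) = y₁ - y₂ ∧
      x₃ = ℓ ^ 2 - a - x₁ - x₂ ∧ y₃ = ℓ * (x₁ - x₃) - y₁ ∧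
      some x₁ y₁ h₁ + some x₂ y₂ h₂ = some x₃ y₃ h₃ := by
  refine ⟨(cubicCurve a b c).slope x₁ x₂ y₁ y₂, _, _, _, ?_, ?_, ?_, add_of_X_ne hx⟩
  · rw [slope_of_X_ne hx, div_mul_cancel₀ _ (sub_ne_zero.2 hx)]
  · simp [addX, cubicCurve]
  · rw [addY, negAddY, cubicCurve_negY]
    ring

lemma cubicCurve_exists_double {a b c x y : F} (h : (cubicCurve a b c).Nonsingular x y)
    (hy : 2 * y ≠ 0) :
    ∃ ℓ x₃ y₃, ∃ h₃ : (cubicCurve a b c).Nonsingular x₃ y₃,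
      ℓ * (2 * y) = 3 * x ^ 2 + 2 * a * x + b ∧ x₃ = ℓ ^ 2 - a - 2 * x ∧ y₃ = ℓ * (x - x₃) - y ∧
      some x y h + some x y h = some x₃ y₃ h₃ := by
  have hy' : y ≠ (cubicCurve a b c).negY x y := by
    rw [cubicCurve_negY]
    exact fun h ↦ hy (by linear_combination h)
  refine ⟨(cubicCurve a b c).slope x x y y, _, _, _, ?_, ?_, ?_, add_self_of_Y_ne hy'⟩
  · rw [slope_of_Y_ne rfl hy', cubicCurve_negY, sub_neg_eq_add, ← two_mul, div_mul_cancel₀ _ hy]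
    simp [cubicCurve]
  · simp [addX, cubicCurve]
    ring
  · rw [addY, negAddY, cubicCurve_negY]
    ring

lemma cubicCurve_add_eq_zero {a b c x y y' : F} (h : (cubicCurve a b c).Nonsingular x y)
    (h' : (cubicCurve a b c).Nonsingular x y') (hy : y = -y') :
    some x y h + some x y' h' = 0 :=
  add_of_Y_eq rfl (by rw [cubicCurve_negY, hy])

omit [DecidableEq F] in
lemma cubicCurve_nonsingular {a b x y : F} (hb : b ≠ 0) (hab : a ^ 2 - 4 * b ≠ 0)
    (h2 : (2 : F) ≠ 0) (h : y ^ 2 = x ^ 3 + a * x ^ 2 + b * x) :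
    (cubicCurve a b 0).Nonsingular x y := by
  rw [← equation_iff_nonsingular_of_Δ_ne_zero, cubicCurve_equation_iff, h, add_zero]
  have : (cubicCurve a b 0).Δ = 2 ^ 4 * (b ^ 2 * (a ^ 2 - 4 * b)) := by
    simp only [WeierstrassCurve.Δ, WeierstrassCurve.b₂, WeierstrassCurve.b₄, WeierstrassCurve.b₆,
      WeierstrassCurve.b₈, cubicCurve]
    ring
  rw [this]
  exact mul_ne_zero (pow_ne_zero _ h2) (mul_ne_zero (pow_ne_zero _ hb) hab)

omit [DecidableEq F] in
lemma cubicCurve_eq_of_nonsingular {a b x y : F} (h : (cubicCurve a b 0).Nonsingular x y) :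
    y ^ 2 = x ^ 3 + a * x ^ 2 + b * x := by
  rw [cubicCurve_equation_iff.1 h.1, add_zero]

omit [DecidableEq F] in
/-- A nonzero `x` is the abscissa of the point `(x, xt)` when `xt² = x² + ax + b`. -/
lemma exists_eq_mul_of_nonsingular {a b x y : F} (h : (cubicCurve a b 0).Nonsingular x y)
    (hx : x ≠ 0) : ∃ t, y = x * t ∧ x * t ^ 2 = x ^ 2 + a * x + b := by
  refine ⟨y / x, by field_simp, ?_⟩
  have := cubicCurve_eq_of_nonsingular h
  field_simp
  linear_combination this

variable {a b : F} (h2 : (2 : F) ≠ 0) (hb : b ≠ 0) (hab : a ^ 2 - 4 * b ≠ 0)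

omit [DecidableEq F] in
include h2 hb hab in
lemma twoIsogeny_nonsingular {x y : F} (h : (cubicCurve a b 0).Nonsingular x y) (hx : x ≠ 0) :
    (cubicCurve (-2 * a) (a ^ 2 - 4 * b) 0).Nonsingular (y ^ 2 / x ^ 2)
      (y * (b - x ^ 2) / x ^ 2) := by
  refine cubicCurve_nonsingular hab ?_ h2 ?_
  · rw [show (-2 * a) ^ 2 - 4 * (a ^ 2 - 4 * b) = 2 ^ 4 * b by ring]
    exact mul_ne_zero (pow_ne_zero _ h2) hb
  · have := cubicCurve_eq_of_nonsingular h
    have h' : b = y ^ 2 / x - x ^ 2 - a * x := by field_simp; linear_combination -this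
    rw [h']
    field_simp
    ring

/-- The `2`-isogeny with kernel generated by `(0, 0)`. -/
def twoIsogenyFun : (cubicCurve a b 0).Point → (cubicCurve (-2 * a) (a ^ 2 - 4 * b) 0).Point
  | .zero => 0
  | .some x _ h =>
    if hx : x = 0 then 0 else .some _ _ (twoIsogeny_nonsingular h2 hb hab h hx)

local notation "φ" => twoIsogenyFun h2 hb hab

lemma twoIsogenyFun_zero : φ 0 = 0 := rfl

lemma twoIsogenyFun_of_eq_zero {x y : F} (h : (cubicCurve a b 0).Nonsingular x y) (hx : x = 0) :
    φ (some x y h) = 0 := dif_pos hx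

lemma twoIsogenyFun_of_ne_zero {x y x' y' : F} (h : (cubicCurve a b 0).Nonsingular x y)
    (h' : (cubicCurve (-2 * a) (a ^ 2 - 4 * b) 0).Nonsingular x' y') (hx : x ≠ 0)
    (hx' : x' = y ^ 2 / x ^ 2) (hy' : y' = y * (b - x ^ 2) / x ^ 2) :
    φ (some x y h) = some x' y' h' := by
  subst hx' hy'
  exact dif_neg hx

lemma twoIsogenyFun_neg (P : (cubicCurve a b 0).Point) : φ (-P) = -φ P := by
  rcases P with _ | ⟨x, y, h⟩
  · rfl
  · rw [neg_some]
    by_cases hx : x = 0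
    · rw [twoIsogenyFun_of_eq_zero _ _ _ _ hx, twoIsogenyFun_of_eq_zero _ _ _ _ hx, _root_.neg_zero]
    · rw [twoIsogenyFun_of_ne_zero h2 hb hab h (twoIsogeny_nonsingular h2 hb hab h hx) hx rfl rfl,
        neg_some]
      refine twoIsogenyFun_of_ne_zero h2 hb hab _ _ hx ?_ ?_ <;> simp only [cubicCurve_negY] <;>
        ring

/-- Translation by the point `(0, 0)`. -/
lemma add_two_torsion {x y : F} (h : (cubicCurve a b 0).Nonsingular x y) (hx : x ≠ 0)
    (h0 : (cubicCurve a b 0).Nonsingular 0 0)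
    (h' : (cubicCurve a b 0).Nonsingular (b / x) (-(b * y / x ^ 2))) :
    some x y h + some 0 0 h0 = some _ _ h' := by
  have := cubicCurve_eq_of_nonsingular h
  refine cubicCurve_add (ℓ := y / x) _ _ _ hx (by field_simp; ring) ?_ ?_
  · field_simp
    linear_combination -this
  · field_simp
    ring

omit [DecidableEq F] in
include h2 hb hab in
lemma two_torsion_nonsingular : (cubicCurve a b 0).Nonsingular 0 0 :=
  cubicCurve_nonsingular hb hab h2 (by ring)

omit [DecidableEq F] in
include h2 hb hab in
lemma add_two_torsion_nonsingular {x y : F} (h : (cubicCurve a b 0).Nonsingular x y) (hx : x ≠ 0) :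
    (cubicCurve a b 0).Nonsingular (b / x) (-(b * y / x ^ 2)) := by
  refine cubicCurve_nonsingular hb hab h2 ?_
  have := cubicCurve_eq_of_nonsingular h
  field_simp
  linear_combination this

lemma twoIsogenyFun_add_two_torsion (P : (cubicCurve a b 0).Point)
    (h0 : (cubicCurve a b 0).Nonsingular 0 0) : φ (P + some 0 0 h0) = φ P := by
  rcases P with _ | ⟨x, y, h⟩
  · exact (congrArg _ (zero_add _)).trans (twoIsogenyFun_of_eq_zero _ _ _ _ rfl)
  by_cases hx : x = 0
  · subst hx
    obtain rfl : y = 0 := by simpa using cubicCurve_eq_of_nonsingular h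
    rw [cubicCurve_add_eq_zero _ _ _root_.neg_zero.symm, twoIsogenyFun_zero,
      twoIsogenyFun_of_eq_zero _ _ _ _ rfl]
  · rw [add_two_torsion h hx _ (add_two_torsion_nonsingular h2 hb hab h hx),
      twoIsogenyFun_of_ne_zero h2 hb hab h (twoIsogeny_nonsingular h2 hb hab h hx) hx rfl rfl]
    refine twoIsogenyFun_of_ne_zero h2 hb hab _ _ (div_ne_zero hb hx) ?_ ?_
    · field_simp
    · field_simp
      ring

lemma twoIsogenyFun_double (P : (cubicCurve a b 0).Point) : φ (P + P) = φ P + φ P := by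
  rcases P with _ | ⟨x, y, h⟩
  · rfl
  have h0 : (cubicCurve a b 0).Nonsingular 0 0 := two_torsion_nonsingular h2 hb hab
  by_cases hx : x = 0
  · subst hx
    obtain rfl : y = 0 := by simpa using cubicCurve_eq_of_nonsingular h
    rw [cubicCurve_add_eq_zero _ _ _root_.neg_zero.symm, twoIsogenyFun_zero,
      twoIsogenyFun_of_eq_zero _ _ _ _ rfl, add_zero]
  have hE := cubicCurve_eq_of_nonsingular h
  have hφ := twoIsogenyFun_of_ne_zero h2 hb hab h (twoIsogeny_nonsingular h2 hb hab h hx) hx rfl rfl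
  by_cases hy : y = 0
  · rw [cubicCurve_add_eq_zero _ _ (by simp [hy]), hφ, cubicCurve_add_eq_zero _ _ (by simp [hy]),
      twoIsogenyFun_zero]
  have h2y := mul_ne_zero h2 hy
  by_cases hxb : b = x ^ 2
  · rw [cubicCurve_double (ℓ := y / x) h h0 h2y, twoIsogenyFun_of_eq_zero _ _ _ _ rfl, hφ,
      cubicCurve_add_eq_zero _ _ (by simp [hxb])]
    · field_simp; rw [hxb] at hE ⊢; linear_combination 2 * hE
    · field_simp; rw [hxb] at hE; linear_combination -hE
    · field_simp; ring
  obtain ⟨t, rfl, ht⟩ := exists_eq_mul_of_nonsingular h hx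
  have ht0 : t ≠ 0 := right_ne_zero_of_mul hy
  obtain ⟨v, hv⟩ : ∃ v, b = x * (2 * t * v + x) :=
    ⟨(b / x - x) / (2 * t), by field_simp; ring⟩
  have ha : a = t ^ 2 - 2 * x - 2 * t * v := by
    apply mul_left_cancel₀ hx
    linear_combination -ht - hv
  have hv0 : v ≠ 0 := by
    rintro rfl
    exact hxb (by linear_combination hv)
  have hns : (cubicCurve a b 0).Nonsingular (v ^ 2) (-v * (x + t * v - v ^ 2)) := by
    refine cubicCurve_nonsingular hb hab h2 ?_
    rw [hv, ha]
    ring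
  have h2Y : 2 * (x * t * (b - x ^ 2) / x ^ 2) ≠ 0 := by
    rw [show 2 * (x * t * (b - x ^ 2) / x ^ 2) = 2 * (t * (2 * t * v)) by rw [hv]; field_simp; ring]
    exact mul_ne_zero h2 (mul_ne_zero ht0 (mul_ne_zero (mul_ne_zero h2 ht0) hv0))
  rw [cubicCurve_double (ℓ := t - v) h hns h2y, hφ,
    twoIsogenyFun_of_ne_zero h2 hb hab hns
      (twoIsogeny_nonsingular h2 hb hab hns (pow_ne_zero 2 hv0)) (pow_ne_zero 2 hv0) rfl rfl]
  · symm
    refine cubicCurve_double (ℓ := (x + t * v + v ^ 2) / v) _ _ h2Y ?_ ?_ ?_ <;> simp only [hv, ha] <;>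
      field_simp <;> ring
  · rw [hv, ha]; ring
  · rw [ha]; ring
  · ring

lemma twoIsogenyFun_add (P Q : (cubicCurve a b 0).Point) : φ (P + Q) = φ P + φ Q := by
  have hT : (cubicCurve a b 0).Nonsingular 0 0 := two_torsion_nonsingular h2 hb hab
  rcases P with _ | ⟨x₁, y₁, h₁⟩
  · exact (congrArg _ (zero_add _)).trans (zero_add _).symm
  rcases Q with _ | ⟨x₂, y₂, h₂⟩
  · exact (congrArg _ (add_zero _)).trans (add_zero _).symm
  by_cases hx₁ : x₁ = 0
  · subst hx₁
    obtain rfl : y₁ = 0 := by simpa using cubicCurve_eq_of_nonsingular h₁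
    rw [add_comm, twoIsogenyFun_add_two_torsion, twoIsogenyFun_of_eq_zero _ _ _ h₁ rfl, zero_add]
  by_cases hx₂ : x₂ = 0
  · subst hx₂
    obtain rfl : y₂ = 0 := by simpa using cubicCurve_eq_of_nonsingular h₂
    rw [twoIsogenyFun_add_two_torsion, twoIsogenyFun_of_eq_zero _ _ _ h₂ rfl, add_zero]
  by_cases hx : x₁ = x₂
  · rcases X_eq_iff.1 hx.symm with h | h
    · rw [h, twoIsogenyFun_double]
    · rw [h, add_neg_cancel, twoIsogenyFun_neg, add_neg_cancel, twoIsogenyFun_zero]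
  by_cases hxb : b = x₁ * x₂
  · have hb₂ : x₂ = b / x₁ := by rw [hxb]; field_simp
    rcases (X_eq_iff (h₁ := h₂) (h₂ := add_two_torsion_nonsingular h2 hb hab h₁ hx₁)).1 hb₂ with
      h | h
    · rw [h, ← add_two_torsion h₁ hx₁ hT, ← add_assoc, twoIsogenyFun_add_two_torsion,
        twoIsogenyFun_add_two_torsion, twoIsogenyFun_double]
    · rw [h, ← add_two_torsion h₁ hx₁ hT, neg_add, add_neg_cancel_left, twoIsogenyFun_neg, ← neg_add,
        twoIsogenyFun_neg, twoIsogenyFun_add_two_torsion, add_neg_cancel,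
        twoIsogenyFun_of_eq_zero _ _ _ _ rfl, _root_.neg_zero]
  obtain ⟨t₁, rfl, ht₁⟩ := exists_eq_mul_of_nonsingular h₁ hx₁
  obtain ⟨t₂, rfl, ht₂⟩ := exists_eq_mul_of_nonsingular h₂ hx₂
  have hd : x₁ - x₂ ≠ 0 := sub_ne_zero.2 hx
  have ht : t₁ ^ 2 ≠ t₂ ^ 2 := by
    intro ht
    have : (x₁ - x₂) * (b - x₁ * x₂) = 0 := by
      linear_combination -x₁ * x₂ * ht + x₂ * ht₁ - x₁ * ht₂
    exact (mul_ne_zero hd (sub_ne_zero.2 hxb)) this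
  obtain ⟨m, rfl⟩ : ∃ m, t₁ = t₂ + m * (x₁ - x₂) := ⟨(t₁ - t₂) / (x₁ - x₂), by field_simp; ring⟩
  have hm : m ≠ 0 := by
    rintro rfl
    simp at ht
  have ha : a = t₂ ^ 2 + 2 * x₁ * t₂ * m + x₁ * m ^ 2 * (x₁ - x₂) - x₁ - x₂ := by
    apply mul_left_cancel₀ hd
    linear_combination ht₂ - ht₁
  have hb' : b = x₂ * t₂ ^ 2 - x₂ ^ 2 - a * x₂ := by linear_combination -ht₂
  have hx₃ : x₁ * x₂ * m ^ 2 ≠ 0 := mul_ne_zero (mul_ne_zero hx₁ hx₂) (pow_ne_zero 2 hm)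
  have hns : (cubicCurve a b 0).Nonsingular (x₁ * x₂ * m ^ 2)
      (x₁ * x₂ * m ^ 2 * (1 / m - t₂ - x₁ * m)) := by
    refine cubicCurve_nonsingular hb hab h2 ?_
    rw [hb', ha]
    field_simp
    ring
  rw [cubicCurve_add (ℓ := t₂ + x₁ * m) h₁ h₂ hns hx (by ring) (by rw [ha]; ring)
      (by field_simp; ring),
    twoIsogenyFun_of_ne_zero h2 hb hab hns (twoIsogeny_nonsingular h2 hb hab hns hx₃) hx₃ rfl rfl,
    twoIsogenyFun_of_ne_zero h2 hb hab h₁ (twoIsogeny_nonsingular h2 hb hab h₁ hx₁) hx₁ rfl rfl,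
    twoIsogenyFun_of_ne_zero h2 hb hab h₂ (twoIsogeny_nonsingular h2 hb hab h₂ hx₂) hx₂ rfl rfl]
  symm
  refine cubicCurve_add (ℓ := t₂ - x₂ * m - 1 / m) _ _ _ ?_ ?_ ?_ ?_
  · rwa [mul_pow, mul_pow, mul_div_cancel_left₀ _ (pow_ne_zero 2 hx₁),
      mul_div_cancel_left₀ _ (pow_ne_zero 2 hx₂)]
  all_goals simp only [hb', ha]; field_simp; ring

omit h2 hb hab

/-- The affine change of variables `(x, y) ↦ (v²x + r, v³y)`. -/
def rescaleFun {a b a' b' : F} (v r : F) (H : ∀ {x y : F}, (cubicCurve a b 0).Nonsingular x y →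
    (cubicCurve a' b' 0).Nonsingular (v ^ 2 * x + r) (v ^ 3 * y)) :
    (cubicCurve a b 0).Point → (cubicCurve a' b' 0).Point
  | .zero => 0
  | .some _ _ h => .some _ _ (H h)

lemma rescaleFun_add {a b a' b' : F} {v r : F} (hv : v ≠ 0)
    (H : ∀ {x y : F}, (cubicCurve a b 0).Nonsingular x y →
      (cubicCurve a' b' 0).Nonsingular (v ^ 2 * x + r) (v ^ 3 * y))
    (ha : v ^ 2 * a = a' + 3 * r) (hb : v ^ 4 * b = b' + 2 * a' * r + 3 * r ^ 2)
    (P Q : (cubicCurve a b 0).Point) :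
    rescaleFun v r H (P + Q) = rescaleFun v r H P + rescaleFun v r H Q := by
  rcases P with _ | ⟨x₁, y₁, h₁⟩
  · exact (congrArg _ (zero_add _)).trans (zero_add _).symm
  rcases Q with _ | ⟨x₂, y₂, h₂⟩
  · exact (congrArg _ (add_zero _)).trans (add_zero _).symm
  have hv2 : v ^ 2 ≠ 0 := pow_ne_zero 2 hv
  have hv3 : v ^ 3 ≠ 0 := pow_ne_zero 3 hv
  by_cases hx : x₁ = x₂
  · subst hx
    by_cases hy : y₁ = -y₂
    · rw [cubicCurve_add_eq_zero _ _ hy]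
      exact (cubicCurve_add_eq_zero (H h₁) (H h₂) (by rw [hy]; ring)).symm
    obtain rfl : y₁ = y₂ := by
      have := cubicCurve_eq_of_nonsingular h₁
      rw [← cubicCurve_eq_of_nonsingular h₂, sq_eq_sq_iff_eq_or_eq_neg] at this
      exact this.resolve_right hy
    have hy0 : 2 * y₁ ≠ 0 := fun h ↦ hy (by linear_combination h)
    obtain ⟨ℓ, x₃, y₃, h₃, hℓ, hx₃, hy₃, h⟩ := cubicCurve_exists_double h₁ hy0
    rw [h]
    refine (cubicCurve_double (ℓ := v * ℓ) (H h₁) (H h₃) ?_ ?_ ?_ ?_).symm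
    · rw [mul_left_comm]
      exact mul_ne_zero hv3 hy0
    · linear_combination v ^ 4 * hℓ + 2 * v ^ 2 * x₁ * ha + hb
    · linear_combination v ^ 2 * hx₃ - ha
    · linear_combination v ^ 3 * hy₃
  · obtain ⟨ℓ, x₃, y₃, h₃, hℓ, hx₃, hy₃, h⟩ := cubicCurve_exists_add h₁ h₂ hx
    rw [h]
    refine (cubicCurve_add (ℓ := v * ℓ) (H h₁) (H h₂) (H h₃) ?_ ?_ ?_ ?_).symm
    · exact fun h ↦ hx (mul_left_cancel₀ hv2 (add_right_cancel h))
    · linear_combination v ^ 3 * hℓ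
    · linear_combination v ^ 2 * hx₃ - ha
    · linear_combination v ^ 3 * hy₃

end Isogeny

section ComplexMultiplication

open WeierstrassCurve.Affine WeierstrassCurve.Affine.Point

variable {F : Type*} [Field F] {ω : F}

lemma cm_curve_ne_zero (h2 : (2 : F) ≠ 0) (hω : ω ^ 2 = ω - 2) :
    3 * ω - 1 ≠ 0 ∧ (3 * ω) ^ 2 - 4 * (3 * ω - 1) ≠ 0 := by
  have hn : ω * (1 - ω) = 2 := by linear_combination -hω
  have h0 : ω ≠ 0 := by rintro rfl; simp at hn; exact h2 hn.symm
  have h1 : 1 - ω ≠ 0 := by intro h; rw [h, mul_zero] at hn; exact h2 hn.symm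
  constructor
  · rw [show 3 * ω - 1 = (1 - ω) ^ 4 by grind]
    exact pow_ne_zero _ h1
  · rw [show (3 * ω) ^ 2 - 4 * (3 * ω - 1) = ω ^ 8 by grind]
    exact pow_ne_zero _ h0

lemma cm_curve_nonsingular (h2 : (2 : F) ≠ 0) (hω : ω ^ 2 = ω - 2) {x y : F}
    (h : y ^ 2 = x * (x + 1) * (x + 3 * ω - 1)) :
    (cubicCurve (3 * ω) (3 * ω - 1) 0).Nonsingular x y :=
  cubicCurve_nonsingular (cm_curve_ne_zero h2 hω).1 (cm_curve_ne_zero h2 hω).2 h2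
    (by linear_combination h)

variable [DecidableEq F]

/-- The endomorphism `(1 + √-7) / 2`, as a `2`-isogeny followed by an isomorphism. -/
lemma exists_cm_endomorphism (h2 : (2 : F) ≠ 0) (hω : ω ^ 2 = ω - 2) :
    ∃ α : (cubicCurve (3 * ω) (3 * ω - 1) 0).Point →+ (cubicCurve (3 * ω) (3 * ω - 1) 0).Point,
      (∀ y h, α (some 0 y h) = 0) ∧
      ∀ {x y x' y'} h (h' : (cubicCurve (3 * ω) (3 * ω - 1) 0).Nonsingular x' y'), x ≠ 0 →
        x' = -(y ^ 2 * (1 + ω)) / (4 * x ^ 2) - 1 →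
        y' = y * (3 * ω - 1 - x ^ 2) * (3 - ω) / (8 * x ^ 2) →
        α (some x y h) = some x' y' h' := by
  obtain ⟨hb, hab⟩ := cm_curve_ne_zero h2 hω
  have h4 : (4 : F) ≠ 0 := by rw [show (4 : F) = 2 * 2 by norm_num]; exact mul_ne_zero h2 h2
  have h8 : (8 : F) ≠ 0 := by rw [show (8 : F) = 2 * 4 by norm_num]; exact mul_ne_zero h2 h4
  have hv : (ω - 1) / 2 ≠ 0 := by
    refine div_ne_zero (fun h ↦ h2 ?_) h2
    linear_combination hω - ω * h
  have hv2 : ((ω - 1) / 2) ^ 2 = -(1 + ω) / 4 := by field_simp; linear_combination 4 * hω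
  have hv3 : ((ω - 1) / 2) ^ 3 = (3 - ω) / 8 := by
    rw [pow_succ, hv2]; field_simp; linear_combination -8 * hω
  have H {x y : F} (h : (cubicCurve (-2 * (3 * ω)) ((3 * ω) ^ 2 - 4 * (3 * ω - 1)) 0).Nonsingular
      x y) : (cubicCurve (3 * ω) (3 * ω - 1) 0).Nonsingular
        (((ω - 1) / 2) ^ 2 * x + -1) (((ω - 1) / 2) ^ 3 * y) := by
    refine cm_curve_nonsingular h2 hω ?_
    have := cubicCurve_eq_of_nonsingular h
    rw [mul_pow, this, hv2, hv3]
    field_simp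
    clear * - hω
    grind
  refine ⟨(AddMonoidHom.mk' (rescaleFun ((ω - 1) / 2) (-1) H) (rescaleFun_add hv H ?_ ?_)).comp
    (AddMonoidHom.mk' (twoIsogenyFun h2 hb hab) (twoIsogenyFun_add h2 hb hab)), ?_, ?_⟩
  · rw [hv2]; field_simp; linear_combination 6 * hω
  · rw [show ((ω - 1) / 2) ^ 4 = (((ω - 1) / 2) ^ 2) ^ 2 by ring, hv2]; field_simp
    clear * - hω
    grind
  · intro y h
    simp only [AddMonoidHom.comp_apply, AddMonoidHom.mk'_apply]
    rw [twoIsogenyFun_of_eq_zero _ _ _ _ rfl]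
    rfl
  · intro x y x' y' h h' hx hx' hy'
    simp only [AddMonoidHom.comp_apply, AddMonoidHom.mk'_apply]
    rw [twoIsogenyFun_of_ne_zero h2 hb hab h (twoIsogeny_nonsingular h2 hb hab h hx) hx rfl rfl,
      rescaleFun, some.injEq, hv2, hv3, hx', hy']
    constructor <;> field_simp
    ring

omit [DecidableEq F] in
lemma cm_image_nonsingular (h2 : (2 : F) ≠ 0) (hω : ω ^ 2 = ω - 2) {x y : F} (hx : x ≠ 0)
    (hE : y ^ 2 = x * (x + 1) * (x + 3 * ω - 1)) :
    (cubicCurve (3 * ω) (3 * ω - 1) 0).Nonsingular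
      (-(y ^ 2 * (1 + ω)) / (4 * x ^ 2) - 1)
      (y * (3 * ω - 1 - x ^ 2) * (3 - ω) / (8 * x ^ 2)) := by
  have h4 : (4 : F) ≠ 0 := by rw [show (4 : F) = 2 * 2 by norm_num]; exact mul_ne_zero h2 h2
  have h8 : (8 : F) ≠ 0 := by rw [show (8 : F) = 2 * 4 by norm_num]; exact mul_ne_zero h2 h4
  refine cm_curve_nonsingular h2 hω ?_
  rw [div_pow, mul_pow, mul_pow, hE]
  field_simp
  clear * - hω
  grind

omit [DecidableEq F] in
/-- The image of `(x, y)` under the conjugate endomorphism `(1 - √-7) / 2`. -/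
lemma cm_conj_image_nonsingular (h2 : (2 : F) ≠ 0) (hω : ω ^ 2 = ω - 2) {x y : F}
    (hx1 : x + 1 ≠ 0) (hE : y ^ 2 = x * (x + 1) * (x + 3 * ω - 1)) :
    (cubicCurve (3 * ω) (3 * ω - 1) 0).Nonsingular
      (y ^ 2 * (ω - 2) / (4 * (x + 1) ^ 2))
      (-(y * ((x + 1) ^ 2 + 3 * ω - 2) * (ω + 2) / (8 * (x + 1) ^ 2))) := by
  have h4 : (4 : F) ≠ 0 := by rw [show (4 : F) = 2 * 2 by norm_num]; exact mul_ne_zero h2 h2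
  have h8 : (8 : F) ≠ 0 := by rw [show (8 : F) = 2 * 4 by norm_num]; exact mul_ne_zero h2 h4
  refine cm_curve_nonsingular h2 hω ?_
  rw [neg_sq, div_pow, mul_pow, mul_pow, hE]
  field_simp
  clear * - hω
  grind

set_option maxHeartbeats 400000 in
lemma sub_cm_image (h2 : (2 : F) ≠ 0) (hω : ω ^ 2 = ω - 2) {x y : F} (hx : x ≠ 0)
    (hx1 : x + 1 ≠ 0) (hxω : x ≠ 1 - ω) (hE : y ^ 2 = x * (x + 1) * (x + 3 * ω - 1))
    (h : (cubicCurve (3 * ω) (3 * ω - 1) 0).Nonsingular x y) :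
    some x y h - some _ _ (cm_image_nonsingular h2 hω hx hE) =
      some _ _ (cm_conj_image_nonsingular h2 hω hx1 hE) := by
  have h4 : (4 : F) ≠ 0 := by rw [show (4 : F) = 2 * 2 by norm_num]; exact mul_ne_zero h2 h2
  have h8 : (8 : F) ≠ 0 := by rw [show (8 : F) = 2 * 4 by norm_num]; exact mul_ne_zero h2 h4
  have h5 : 5 + ω ≠ 0 := fun h0 ↦ mul_ne_zero h4 h8 (by linear_combination (6 - ω) * h0 + hω)
  have hns : (cubicCurve (3 * ω) (3 * ω - 1) 0).Nonsingular
      (-(y ^ 2 * (1 + ω)) / (4 * x ^ 2) - 1)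
      (-(y * (3 * ω - 1 - x ^ 2) * (3 - ω) / (8 * x ^ 2))) :=
    cubicCurve_negY (3 * ω) (3 * ω - 1) 0 (-(y ^ 2 * (1 + ω)) / (4 * x ^ 2) - 1)
      (y * (3 * ω - 1 - x ^ 2) * (3 - ω) / (8 * x ^ 2)) ▸
      (nonsingular_neg _ _).2 (cm_image_nonsingular h2 hω hx hE)
  refine (sub_eq_add_neg _ _).trans ?_
  rw [cubicCurve_neg (cm_image_nonsingular h2 hω hx hE) hns]
  refine cubicCurve_add (ℓ := y * (x + 1 - ω) / (2 * x * (x + 1))) h hns _ ?_ ?_ ?_ ?_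
  · intro hxx
    rw [hE] at hxx
    field_simp at hxx
    have : (x + 1) * ((5 + ω) * (x - (1 - ω))) = 0 := by
      clear * - hω hxx
      grind
    simp [hx1, h5, sub_eq_zero, hxω] at this
  · rw [hE]
    field_simp
    clear * - hω
    grind
  · rw [div_pow, mul_pow, hE]
    field_simp
    clear * - hω
    grind
  · rw [hE]
    field_simp
    clear * - hω
    grind

lemma exists_endomorphism_sq_eq (h2 : (2 : F) ≠ 0) (hω : ω ^ 2 = ω - 2) :
    ∃ α : (cubicCurve (3 * ω) (3 * ω - 1) 0).Point →+ (cubicCurve (3 * ω) (3 * ω - 1) 0).Point,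
      ∀ P, α (α P) = α P - 2 • P := by
  obtain ⟨α, hα0, hα⟩ := exists_cm_endomorphism h2 hω
  refine ⟨α, fun P ↦ ?_⟩
  have h4 : (4 : F) ≠ 0 := by rw [show (4 : F) = 2 * 2 by norm_num]; exact mul_ne_zero h2 h2
  have h8 : (8 : F) ≠ 0 := by rw [show (8 : F) = 2 * 4 by norm_num]; exact mul_ne_zero h2 h4
  have hW : (cubicCurve (3 * ω) (3 * ω - 1) 0).Nonsingular (-1) 0 :=
    cm_curve_nonsingular h2 hω (by ring)
  rcases P with _ | ⟨x, y, h⟩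
  · rw [← zero_def]
    simp
  by_cases hx : x = 0
  · subst hx
    obtain rfl : y = 0 := by simpa using cubicCurve_eq_of_nonsingular h
    rw [hα0, _root_.map_zero, two_nsmul, cubicCurve_add_eq_zero _ _ _root_.neg_zero.symm, sub_zero]
  have hE : y ^ 2 = x * (x + 1) * (x + 3 * ω - 1) := by
    rw [cubicCurve_eq_of_nonsingular h]; ring
  by_cases hy : y = 0
  · subst hy
    rw [hα h hW hx (by simp) (by simp), two_nsmul, cubicCurve_add_eq_zero _ _ _root_.neg_zero.symm,
      sub_zero, hα hW hW (by simp) (by simp) (by simp)]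
  have hx1 : x + 1 ≠ 0 := by
    intro h1
    rw [h1] at hE
    exact hy (by simpa using hE)
  have h2y : 2 * y ≠ 0 := mul_ne_zero h2 hy
  by_cases hxω : x = 1 - ω
  · have hneg : α (some x y h) = -some x y h := by
      rw [cubicCurve_neg h (cm_curve_nonsingular h2 hω (by rw [← hE]; ring))]
      refine hα h _ hx ?_ ?_
      · field_simp
        rw [hE, hxω]
        clear * - hω
        grind
      · field_simp
        rw [hxω]
        clear * - hω
        grind
    have hdouble : some x y h + some x y h = some (-1) 0 hW := by
      refine cubicCurve_double (ℓ := y / (x + 1)) h hW h2y ?_ ?_ ?_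
      · field_simp
        rw [hE, hxω]
        clear * - hω
        grind
      · field_simp
        rw [hE, hxω]
        clear * - hω
        grind
      · field_simp
        ring
    have h4P : some x y h + some x y h + (some x y h + some x y h) = 0 := by
      rw [hdouble, cubicCurve_add_eq_zero _ _ _root_.neg_zero.symm]
    rw [hneg, map_neg, hneg, neg_neg, two_nsmul, eq_sub_iff_add_eq, eq_neg_iff_add_eq_zero, ← h4P]
    abel
  have hω2 : ω - 2 ≠ 0 := by
    rw [← hω]
    refine pow_ne_zero 2 fun h0 ↦ h2 ?_
    rw [h0] at hω
    linear_combination hω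
  have hR : α (some _ _ (cm_conj_image_nonsingular h2 hω hx1 hE)) = some x y h + some x y h := by
    obtain ⟨ℓ, x₃, y₃, h₃, hℓ, hx₃, hy₃, hP⟩ := cubicCurve_exists_double h h2y
    obtain rfl : ℓ = (3 * x ^ 2 + 2 * (3 * ω) * x + (3 * ω - 1)) / (2 * y) := by
      rw [eq_div_iff h2y, hℓ]
    rw [hP]
    refine hα _ h₃ ?_ ?_ ?_
    · exact div_ne_zero (mul_ne_zero (pow_ne_zero 2 hy) hω2)
        (mul_ne_zero h4 (pow_ne_zero 2 hx1))
    · rw [hx₃]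
      field_simp
      rw [hE]
      clear * - hω
      grind
    · rw [hy₃, hx₃]
      field_simp
      rw [show y ^ 4 = (y ^ 2) ^ 2 by ring, hE]
      clear * - hω
      grind
  have hsub := sub_cm_image h2 hω hx hx1 hxω hE h
  rw [← hα h (cm_image_nonsingular h2 hω hx hE) hx rfl rfl] at hsub
  rw [two_nsmul, ← hR, ← hsub, map_sub, sub_sub_cancel]

end ComplexMultiplication

section PointCount

open WeierstrassCurve.Affine WeierstrassCurve.Affine.Point

section

variable {F : Type*} [Field F]

instance [Finite F] (W : WeierstrassCurve.Affine F) : Finite W.Point :=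
  .of_equiv (Option {xy : F × F // W.Nonsingular xy.1 xy.2}) (nonsingularPointEquiv W).symm

lemma natCard_point_of_sum_eq_zero [Fintype F] [DecidableEq F] {a b : F} (h2 : (2 : F) ≠ 0)
    (hb : b ≠ 0) (hab : a ^ 2 - 4 * b ≠ 0)
    (h : ∑ x, quadraticChar F (x ^ 3 + a * x ^ 2 + b * x) = 0) :
    Nat.card (cubicCurve a b 0).Point = Fintype.card F + 1 := by
  have e : {xy : F × F // (cubicCurve a b 0).Nonsingular xy.1 xy.2} ≃
      {xy : F × F // xy.2 ^ 2 = xy.1 ^ 3 + a * xy.1 ^ 2 + b * xy.1} :=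
    Equiv.subtypeEquivRight fun _ ↦
      ⟨cubicCurve_eq_of_nonsingular, cubicCurve_nonsingular hb hab h2⟩
  have hcard := card_sq_eq_add_sum_quadraticChar (F := F)
    (fun h ↦ h2 (by exact_mod_cast (ringChar.spec F 2).2 h.dvd))
    fun x : F ↦ x ^ 3 + a * x ^ 2 + b * x
  rw [h, add_zero, Nat.cast_inj] at hcard
  rw [Nat.card_congr (nonsingularPointEquiv _), ← hcard, ← Nat.card_congr e]
  exact Finite.card_option

lemma seven_torsion_curve_ne_zero (h2 : (2 : F) ≠ 0) (h7 : (7 : F) ≠ 0) :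
    (5488 : F) ≠ 0 ∧ (-147 : F) ^ 2 - 4 * 5488 ≠ 0 := by
  have hb : (5488 : F) ≠ 0 := by
    rw [show (5488 : F) = 2 ^ 4 * 7 ^ 3 by norm_num]
    exact mul_ne_zero (pow_ne_zero _ h2) (pow_ne_zero _ h7)
  have hab : (-147 : F) ^ 2 - 4 * 5488 ≠ 0 := by
    rw [show (-147 : F) ^ 2 - 4 * 5488 = -7 ^ 3 by norm_num]
    exact neg_ne_zero.2 (pow_ne_zero _ h7)
  exact ⟨hb, hab⟩

lemma exists_seven_torsion_double {c : F} [DecidableEq F] (h2 : (2 : F) ≠ 0) (h7 : (7 : F) ≠ 0)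
    (hc : c ^ 3 + c ^ 2 - 2 * c - 1 = 0) :
    ∃ (h : (cubicCurve (-147) 5488 0).Nonsingular (56 - 28 * c) (196 * c))
      (h' : (cubicCurve (-147) 5488 0).Nonsingular (56 - 28 * (1 - c - c ^ 2))
        (196 * (1 - c - c ^ 2))),
      some _ _ h + some _ _ h = some _ _ h' := by
  obtain ⟨hb, hab⟩ := seven_torsion_curve_ne_zero h2 h7
  have hy : 2 * (196 * c) ≠ 0 := by
    refine left_ne_zero_of_mul (b := c ^ 2 + c - 2) ?_
    rw [show 2 * (196 * c) * (c ^ 2 + c - 2) = 2 ^ 3 * 7 ^ 2 by linear_combination 392 * hc]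
    exact mul_ne_zero (pow_ne_zero _ h2) (pow_ne_zero _ h7)
  have hns {d : F} (hd : d ^ 3 + d ^ 2 - 2 * d - 1 = 0) :
      (cubicCurve (-147) 5488 0).Nonsingular (56 - 28 * d) (196 * d) :=
    cubicCurve_nonsingular hb hab h2 (by linear_combination 21952 * hd)
  refine ⟨hns hc, hns (by grind), cubicCurve_double (ℓ := -4 * c ^ 2 + 2 * c + 5) _ _ hy ?_ ?_ ?_⟩
  · linear_combination -1568 * hc
  · grind
  · grind

end

variable {p : ℕ} [Fact p.Prime]

lemma exists_cubic_root_of_mod_seven_eq_one (hp : p % 7 = 1) :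
    ∃ c : ZMod p, c ^ 3 + c ^ 2 - 2 * c - 1 = 0 := by
  have : Fact (Nat.Prime 7) := ⟨by norm_num⟩
  obtain ⟨ζ, hζ⟩ := exists_prime_orderOf_dvd_card (G := (ZMod p)ˣ) 7
    (by rw [ZMod.card_units]; omega)
  refine ⟨(ζ : ZMod p) + (ζ : ZMod p)⁻¹, ?_⟩
  have h7 : (ζ : ZMod p) ^ 7 = 1 := by rw [← Units.val_pow_eq_pow_val, ← hζ, pow_orderOf_eq_one]; rfl
  have h1 : (ζ : ZMod p) - 1 ≠ 0 := by
    intro h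
    rw [sub_eq_zero, Units.val_eq_one] at h
    simp [h] at hζ
  have h0 : (ζ : ZMod p) ≠ 0 := ζ.ne_zero
  have h : (ζ : ZMod p) ^ 6 + ζ ^ 5 + ζ ^ 4 + ζ ^ 3 + ζ ^ 2 + ζ + 1 = 0 :=
    mul_left_cancel₀ h1 (by linear_combination h7)
  field_simp
  linear_combination h

lemma exists_sq_eq_sub_two_of_isSquare (h2 : (2 : ZMod p) ≠ 0) (h : IsSquare (-7 : ZMod p)) :
    ∃ ω : ZMod p, ω ^ 2 = ω - 2 := by
  obtain ⟨s, hs⟩ := h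
  refine ⟨(1 + s) / 2, ?_⟩
  field_simp
  linear_combination -hs

lemma sum_quadraticChar_ne_zero_of_isSquare (hp : p ≠ 2) (hp7 : p ≠ 7)
    (h : IsSquare (-7 : ZMod p)) :
    ∑ x, quadraticChar (ZMod p) (4 * x ^ 3 - 3 * x ^ 2 - 8 * x - 4) ≠ 0 := by
  intro hS
  have h2 : (2 : ZMod p) ≠ 0 := by
    exact_mod_cast (ZMod.natCast_eq_zero_iff 2 p).not.2
      fun hd ↦ hp ((Nat.prime_dvd_prime_iff_eq Fact.out Nat.prime_two).1 hd)
  have h7 : (7 : ZMod p) ≠ 0 := by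
    exact_mod_cast (ZMod.natCast_eq_zero_iff 7 p).not.2
      fun hd ↦ hp7 ((Nat.prime_dvd_prime_iff_eq Fact.out (by norm_num)).1 hd)
  have h4 : (4 : ZMod p) ≠ 0 := by
    rw [show (4 : ZMod p) = 2 * 2 by norm_num]; exact mul_ne_zero h2 h2
  have h16 : (16 : ZMod p) ≠ 0 := by
    rw [show (16 : ZMod p) = 4 * 4 by norm_num]; exact mul_ne_zero h4 h4
  have h28 : (28 : ZMod p) ≠ 0 := by
    rw [show (28 : ZMod p) = 4 * 7 by norm_num]; exact mul_ne_zero h4 h7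
  have hsq := isSquare_natCast_zmod_seven h
  by_cases hmod : p % 7 = 1
  · obtain ⟨hb, hab⟩ := seven_torsion_curve_ne_zero h2 h7
    obtain ⟨c, hc⟩ := exists_cubic_root_of_mod_seven_eq_one hmod
    obtain ⟨h₁, h₂, hP⟩ := exists_seven_torsion_double h2 h7 hc
    obtain ⟨_, h₃, hQ⟩ := exists_seven_torsion_double (c := 1 - c - c ^ 2) h2 h7 (by grind)
    obtain ⟨_, h₄, hR⟩ := exists_seven_torsion_double
      (c := 1 - (1 - c - c ^ 2) - (1 - c - c ^ 2) ^ 2) h2 h7 (by grind)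
    have hcycle : some _ _ h₄ = some _ _ h₁ := by
      simp only [some.injEq]
      constructor <;> grind
    have hS' : ∑ x : ZMod p, quadraticChar (ZMod p) (x ^ 3 + -147 * x ^ 2 + 5488 * x) = 0 := by
      refine (sum_quadraticChar_eq_zero_iff (a := -1 / 28) (b := 2) (c := -5488) (d := 1)
        ?_ ?_ one_ne_zero fun x ↦ ?_).1 hS
      · exact div_ne_zero (neg_ne_zero.2 one_ne_zero) h28
      · exact neg_ne_zero.2 hb
      · field_simp
        ring
    have hcard := natCard_point_of_sum_eq_zero h2 hb hab hS'
    have h7P : 7 • some _ _ h₁ = 0 := by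
      have : 8 • some _ _ h₁ = some _ _ h₁ := by
        conv_rhs => rw [← hcycle, ← hR, ← hQ, ← hP]
        abel
      exact add_eq_right.1 ((succ_nsmul _ 7).symm.trans this)
    have := Fact.mk (show Nat.Prime 7 by norm_num)
    have hdvd := addOrderOf_dvd_natCard (some _ _ h₁)
    rw [addOrderOf_eq_prime h7P (some_ne_zero _), hcard, ZMod.card] at hdvd
    omega
  · obtain ⟨ω, hω⟩ := exists_sq_eq_sub_two_of_isSquare h2 h
    obtain ⟨hb, hab⟩ := cm_curve_ne_zero h2 hω
    have hd : 2 * ω - 1 ≠ 0 := fun h0 ↦ h7 (by linear_combination 4 * hω - (2 * ω - 1) * h0)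
    have hS' : ∑ x : ZMod p, quadraticChar (ZMod p)
        (x ^ 3 + 3 * ω * x ^ 2 + (3 * ω - 1) * x) = 0 := by
      refine (sum_quadraticChar_eq_zero_iff (div_ne_zero hd h4) h16 (pow_ne_zero 3 hd)
        fun x ↦ (cubic_comp_eq hω h4 x).trans ?_).1 hS
      rw [show (1 - ω) ^ 4 = 3 * ω - 1 by linear_combination (ω ^ 2 - 3 * ω + 1) * hω]
      ring
    obtain ⟨α, hα⟩ := exists_endomorphism_sq_eq h2 hω
    have hcard := isSquare_card_of_quadratic_endomorphism α hα
    rw [natCard_point_of_sum_eq_zero h2 hb hab hS', ZMod.card] at hcard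
    have hp0 : (p : ZMod 7) ≠ 0 := fun h0 ↦ hp7
      ((Nat.prime_dvd_prime_iff_eq (by norm_num) Fact.out).1
        ((ZMod.natCast_eq_zero_iff p 7).1 h0)).symm
    have hp1 : (p : ZMod 7) ≠ 1 := fun h1 ↦ hmod ((ZMod.natCast_eq_natCast_iff' p 1 7).1 (by simpa))
    push_cast at hcard
    generalize (p : ZMod 7) = q at *
    revert q
    decide

end PointCount

lemma natCard_weierstrass_eq {F : Type*} [Field F] (h2 : (2 : F) ≠ 0) :
    Nat.card {xy : F × F // xy.2 ^ 2 + xy.1 * xy.2 = xy.1 ^ 3 - xy.1 ^ 2 - 2 * xy.1 - 1} =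
      Nat.card {xy : F × F // xy.2 ^ 2 = 4 * xy.1 ^ 3 - 3 * xy.1 ^ 2 - 8 * xy.1 - 4} :=
  Nat.card_congr
    { toFun := fun z ↦ ⟨(z.1.1, 2 * z.1.2 + z.1.1), by linear_combination 4 * z.2⟩
      invFun := fun z ↦ ⟨(z.1.1, (z.1.2 - z.1.1) / 2), by
        have := z.2
        field_simp
        linear_combination this⟩
      left_inv := fun z ↦ Subtype.ext (Prod.ext rfl (by field_simp; ring))
      right_inv := fun z ↦ Subtype.ext (Prod.ext rfl (by field_simp; ring)) }

/-- **CM criterion for the vanishing of the trace of Frobenius of `X₀(49)`.**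
Let `E₁` be the elliptic curve with minimal Weierstrass equation
`y² + xy = x³ − x² − 2x − 1` (the modular curve `X₀(49)`). For every prime `p ≥ 5` with
`p ≠ 7`, the trace of Frobenius `a_p = p + 1 − #E₁(𝔽_p)` vanishes if and only if the
Legendre symbol `(−7 / p)` equals `−1`. Here `#E₁(𝔽_p)` counts the affine solutions of
the Weierstrass equation over `𝔽_p` together with the point at infinity. -/
theorem trace_of_frobenius_X0_49_eq_zero_iff
    (p : ℕ) [Fact p.Prime] (hp5 : 5 ≤ p) (hp7 : p ≠ 7) :
    ((p : ℤ) + 1 -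
        (1 + Nat.card {xy : ZMod p × ZMod p //
          xy.2 ^ 2 + xy.1 * xy.2 = xy.1 ^ 3 - xy.1 ^ 2 - 2 * xy.1 - 1} : ℕ) = 0) ↔
      legendreSym p (-7) = -1 := by
  have h2 : (2 : ZMod p) ≠ 0 := by
    exact_mod_cast (ZMod.natCast_eq_zero_iff 2 p).not.2 fun hd ↦ by
      have := Nat.le_of_dvd two_pos hd
      omega
  have hp2 : p ≠ 2 := by omega
  have hcard := card_sq_eq_add_sum_quadraticChar (by rwa [ZMod.ringChar_zmod_n])
    fun x : ZMod p ↦ 4 * x ^ 3 - 3 * x ^ 2 - 8 * x - 4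
  rw [ZMod.card, ← natCard_weierstrass_eq h2] at hcard
  have hsum : ∑ x, quadraticChar (ZMod p) (4 * x ^ 3 - 3 * x ^ 2 - 8 * x - 4) = 0 ↔
      legendreSym p (-7) = -1 := by
    rw [legendreSym.eq_neg_one_iff, Int.cast_neg, Int.cast_ofNat]
    exact ⟨fun h hs ↦ sum_quadraticChar_ne_zero_of_isSquare hp2 hp7 hs h,
      sum_quadraticChar_eq_zero_of_not_isSquare hp2⟩
  rw [← hsum, Nat.cast_add, hcard, Nat.cast_one]
  constructor <;> intro h <;> linarith
end
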